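/- arXiv:1602.00390 — 4 statements merged into one kernel-verified Lean document; each statement's English description precedes it below -/
import Mathlib

section
/- Let n ≥ 2 and let ‖·‖ : ℝⁿ → [0,∞) be a continuous function with ‖x‖ > 0 for x ≠ 0, ‖cx‖ = c‖x‖ for all c > 0, and ‖x+y‖ ≤ ‖x‖ + ‖y‖; set d(x,y) := ‖y−x‖, and let ‖α‖_* := sup{α(x) : ‖x‖ ≤ 1} denote the dual of a linear functional α on ℝⁿ. Let Φ : ℝⁿ → ℝ be continuous and K-convex for some K > 0, and let 𝔪 be the probability measure with density e^{−Φ} with respect to Lebesgue measure. Then for every C^∞ compactly supported function u : ℝⁿ → ℝ with 0 ≤ u ≤ 1, one has the Bobkov-type functional inequality √K · 𝒩(∫_{ℝⁿ} u d𝔪) ≤ ∫_{ℝⁿ} √( K·𝒩(u(x))² + ‖Du(x)‖_*² ) d𝔪(x), where Du(x) is the derivative of u at x. -/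
open MeasureTheory

/-- The standard Gaussian cumulative distribution function
`φ(c) = (2π)^{-1/2} ∫_{-∞}^c e^{-b²/2} db`. -/
noncomputable def gaussCDF (c : ℝ) : ℝ :=
  (Real.sqrt (2 * Real.pi))⁻¹ * ∫ b in Set.Iic c, Real.exp (-b ^ 2 / 2)

/-- The Gaussian isoperimetric function `𝒩 := φ' ∘ φ⁻¹` on `(0,1)`, explicitly
`𝒩(θ) = (2π)^{-1/2} e^{-φ⁻¹(θ)²/2}`, extended by `𝒩(0) = 𝒩(1) = 0`. -/
noncomputable def gaussIsop (θ : ℝ) : ℝ :=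
  if θ ∈ Set.Ioo (0 : ℝ) 1 then
    (Real.sqrt (2 * Real.pi))⁻¹ * Real.exp (-(Function.invFun gaussCDF θ) ^ 2 / 2)
  else 0

/-- The dual norm of a linear functional `α` with respect to an asymmetric norm
`Nm`: `‖α‖_* := sup { α x | Nm x ≤ 1 }`. -/
noncomputable def dualNorm {n : ℕ} (Nm : (Fin n → ℝ) → ℝ)
    (α : (Fin n → ℝ) →L[ℝ] ℝ) : ℝ :=
  sSup {r : ℝ | ∃ x : Fin n → ℝ, Nm x ≤ 1 ∧ r = α x}

/-- One-dimensional Brunn-Minkowski inequality. -/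
theorem volume_add_le_of_add_mem {A B C : Set ℝ} (hA : MeasurableSet A) (hB : MeasurableSet B)
    (hA0 : A.Nonempty) (hB0 : B.Nonempty) (hC : ∀ a ∈ A, ∀ b ∈ B, a + b ∈ C) :
    volume A + volume B ≤ volume C := by
  have compact_case : ∀ K L : Set ℝ, IsCompact K → IsCompact L → K.Nonempty → L.Nonempty →
      (∀ a ∈ K, ∀ b ∈ L, a + b ∈ C) → volume K + volume L ≤ volume C := by
    intro K L hK hL hK0 hL0 hKL
    obtain ⟨a, haK, ha⟩ := hK.exists_isGreatest hK0
    obtain ⟨b, hbL, hb⟩ := hL.exists_isLeast hL0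
    have h1 : volume K = volume ((fun x => x + b) '' K) := by
      simp
    have h2 : volume L = volume ((fun x => a + x) '' L) := by
      simp
    have hm2 : MeasurableSet ((fun x => a + x) '' L) :=
      (hL.image (by fun_prop)).isClosed.measurableSet
    have hdisj : AEDisjoint volume ((fun x => x + b) '' K) ((fun x => a + x) '' L) := by
      refine measure_mono_null (t := {a + b}) ?_ (by simp)
      rintro _ ⟨⟨x, hx, rfl⟩, ⟨y, hy, hxy⟩⟩
      have := ha hx
      have := hb hy
      simp only [Set.mem_singleton_iff] at *
      linarith
    rw [h1, h2, ← measure_union₀ hm2.nullMeasurableSet hdisj]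
    apply measure_mono
    rintro _ (⟨x, hx, rfl⟩ | ⟨x, hx, rfl⟩)
    · exact hKL _ hx _ hbL
    · exact hKL _ haK _ hx
  have hsup : ∀ S : Set ℝ, MeasurableSet S →
      volume S = ⨆ K : Set ℝ, ⨆ _ : K ⊆ S ∧ IsCompact K, volume K := by
    intro S hS
    simp_rw [iSup_and]
    exact hS.measure_eq_iSup_isCompact volume
  rw [hsup A hA, hsup B hB]
  refine ENNReal.biSup_add_biSup_le' ⟨∅, by simp⟩ ⟨∅, by simp⟩ fun K hK L hL => ?_
  obtain ⟨a, ha⟩ := hA0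
  obtain ⟨b, hb⟩ := hB0
  refine (add_le_add (measure_mono (Set.subset_insert a K))
    (measure_mono (Set.subset_insert b L))).trans
    (compact_case _ _ (hK.2.insert a) (hL.2.insert b) (Set.insert_nonempty _ _)
      (Set.insert_nonempty _ _) fun x hx y hy => hC x ?_ y ?_)
  · exact Set.insert_subset ha hK.1 hx
  · exact Set.insert_subset hb hL.1 hy

theorem volume_convexComb_le {A B C : Set ℝ} (hA : MeasurableSet A) (hB : MeasurableSet B)
    (hA0 : A.Nonempty) (hB0 : B.Nonempty) {l : ℝ} (hl0 : 0 < l) (hl1 : l < 1)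
    (hC : ∀ a ∈ A, ∀ b ∈ B, (1 - l) * a + l * b ∈ C) :
    ENNReal.ofReal (1 - l) * volume A + ENNReal.ofReal l * volume B ≤ volume C := by
  have h1 := Measure.addHaar_smul volume (1 - l) A
  have h2 := Measure.addHaar_smul volume l B
  simp only [Module.finrank_self, pow_one, abs_of_pos hl0, abs_of_pos (sub_pos.2 hl1)] at h1 h2
  rw [← h1, ← h2]
  refine volume_add_le_of_add_mem (hA.const_smul_of_ne_zero (sub_pos.2 hl1).ne')
    (hB.const_smul_of_ne_zero hl0.ne') (hA0.smul_set) (hB0.smul_set) ?_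
  rintro _ ⟨a, ha, rfl⟩ _ ⟨b, hb, rfl⟩
  exact hC a ha b hb

theorem lintegral_convexComb_le_of_normalized {f g h : ℝ → ℝ} (hf : Measurable f)
    (hg : Measurable g) (hh : Measurable h) (hf0 : ∀ x, 0 ≤ f x) (hg0 : ∀ x, 0 ≤ g x)
    (hh0 : ∀ x, 0 ≤ h x) (hf1 : ∀ x, f x ≤ 1) (hg1 : ∀ x, g x ≤ 1)
    (hfs : ∀ t < 1, ∃ x, t < f x) (hgs : ∀ t < 1, ∃ x, t < g x)
    {l : ℝ} (hl0 : 0 < l) (hl1 : l < 1)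
    (H : ∀ x y t, 0 < t → t < f x → t < g y → t < h ((1 - l) * x + l * y)) :
    ENNReal.ofReal (1 - l) * (∫⁻ x, ENNReal.ofReal (f x)) + ENNReal.ofReal l *
      (∫⁻ x, ENNReal.ofReal (g x)) ≤ ∫⁻ x, ENNReal.ofReal (h x) := by
  rw [lintegral_eq_lintegral_meas_lt volume (ae_of_all _ hf0) hf.aemeasurable,
    lintegral_eq_lintegral_meas_lt volume (ae_of_all _ hg0) hg.aemeasurable,
    lintegral_eq_lintegral_meas_lt volume (ae_of_all _ hh0) hh.aemeasurable]
  have mble : ∀ k : ℝ → ℝ, Measurable fun t : ℝ => volume {a | t < k a} := fun k =>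
    Antitone.measurable fun s t hst => measure_mono fun a ha => lt_of_le_of_lt hst ha
  rw [← lintegral_const_mul _ (mble f), ← lintegral_const_mul _ (mble g),
    ← lintegral_add_left ((mble f).const_mul _)]
  refine setLIntegral_mono (mble h) fun t ht => ?_
  rcases lt_or_ge t 1 with h1 | h1
  · exact volume_convexComb_le (measurableSet_lt measurable_const hf)
      (measurableSet_lt measurable_const hg) (hfs t h1) (hgs t h1) hl0 hl1
      fun a ha b hb => H a b t ht ha hb
  · have e1 : {a | t < f a} = ∅ := by
      ext a; simpa using (hf1 a).trans h1
    have e2 : {a | t < g a} = ∅ := by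
      ext a; simpa using (hg1 a).trans h1
    simp [e1, e2]

open ENNReal in
theorem ENNReal.geom_mean_le_arith_mean (a b : ℝ≥0∞) {l : ℝ} (hl0 : 0 < l) (hl1 : l < 1) :
    a ^ (1 - l) * b ^ l ≤ ENNReal.ofReal (1 - l) * a + ENNReal.ofReal l * b := by
  have h1 : 0 < 1 - l := sub_pos.2 hl1
  rcases eq_or_ne a ⊤ with rfl | ha
  · rw [ENNReal.mul_top (by simpa using h1)]; simp
  rcases eq_or_ne b ⊤ with rfl | hb
  · rw [ENNReal.mul_top (by simpa using hl0)]; simp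
  lift a to NNReal using ha
  lift b to NNReal using hb
  have := NNReal.geom_mean_le_arith_mean2_weighted (1 - l).toNNReal l.toNNReal a b
    (by rw [← Real.toNNReal_add h1.le hl0.le]; simp)
  rw [Real.coe_toNNReal _ h1.le, Real.coe_toNNReal _ hl0.le] at this
  rw [← ENNReal.coe_rpow_of_nonneg _ h1.le, ← ENNReal.coe_rpow_of_nonneg _ hl0.le]
  unfold ENNReal.ofReal
  exact_mod_cast this

open ENNReal in
theorem prekopa_leindler_real_of_bdd {f g h : ℝ → ℝ≥0∞} (hf : Measurable f)
    (hg : Measurable g) (hh : Measurable h) {l : ℝ} (hl0 : 0 < l) (hl1 : l < 1)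
    (hfb : ⨆ x, f x ≠ ∞) (hgb : ⨆ x, g x ≠ ∞)
    (H : ∀ x y, f x ^ (1 - l) * g y ^ l ≤ h ((1 - l) * x + l * y)) :
    (∫⁻ x, f x) ^ (1 - l) * (∫⁻ x, g x) ^ l ≤ ∫⁻ x, h x := by
  have h1 : 0 < 1 - l := sub_pos.2 hl1
  set a := ⨆ x, f x with ha
  set b := ⨆ x, g x with hb
  rcases eq_or_ne a 0 with ha0 | ha0
  · have : ∀ x, f x = 0 := by simpa [ha] using ha0
    simp [this, h1]
  rcases eq_or_ne b 0 with hb0 | hb0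
  · have : ∀ x, g x = 0 := by simpa [hb] using hb0
    simp [this, hl0]
  have hfa : ∀ x, f x ≤ a := le_iSup f
  have hgb' : ∀ x, g x ≤ b := le_iSup g
  set c := a ^ (1 - l) * b ^ l with hc
  have hc0 : c ≠ 0 := by
    simp [hc, ha0, hb0, hfb, hgb, ENNReal.rpow_eq_zero_iff]
  have hct : c ≠ ∞ := ENNReal.mul_ne_top (ENNReal.rpow_ne_top_of_nonneg h1.le hfb)
    (ENNReal.rpow_ne_top_of_nonneg hl0.le hgb)
  have key := lintegral_convexComb_le_of_normalized
    (f := fun x => (f x / a).toReal) (g := fun x => (g x / b).toReal)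
    (h := fun x => (min (h x / c) 1).toReal)
    (by fun_prop) (by fun_prop) (by fun_prop) (fun _ => toReal_nonneg) (fun _ => toReal_nonneg)
    (fun _ => toReal_nonneg)
    (fun x => toReal_le_of_le_ofReal zero_le_one
      (by simpa using ENNReal.div_le_of_le_mul (by simpa using hfa x)))
    (fun x => toReal_le_of_le_ofReal zero_le_one
      (by simpa using ENNReal.div_le_of_le_mul (by simpa using hgb' x)))
    ?_ ?_ hl0 hl1 ?_
  · have hfe : ∀ x, ENNReal.ofReal (f x / a).toReal = f x / a := fun x =>
      ofReal_toReal (ENNReal.div_ne_top (ne_top_of_le_ne_top hfb (hfa x)) ha0)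
    have hge : ∀ x, ENNReal.ofReal (g x / b).toReal = g x / b := fun x =>
      ofReal_toReal (ENNReal.div_ne_top (ne_top_of_le_ne_top hgb (hgb' x)) hb0)
    have hhe : ∀ x, ENNReal.ofReal (min (h x / c) 1).toReal = min (h x / c) 1 := fun x =>
      ofReal_toReal (ne_top_of_le_ne_top one_ne_top (min_le_right _ _))
    simp only [hfe, hge, hhe] at key
    have key2 := (ENNReal.geom_mean_le_arith_mean _ _ hl0 hl1).trans
      (key.trans (lintegral_mono fun x => min_le_left (h x / c) 1))
    simp only [div_eq_mul_inv] at key2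
    rw [lintegral_mul_const _ hf, lintegral_mul_const _ hg, lintegral_mul_const _ hh,
      ENNReal.mul_rpow_of_nonneg _ _ h1.le, ENNReal.mul_rpow_of_nonneg _ _ hl0.le,
      ENNReal.inv_rpow, ENNReal.inv_rpow, mul_mul_mul_comm, ← ENNReal.mul_inv
        (Or.inr (ENNReal.rpow_ne_top_of_nonneg hl0.le hgb))
        (Or.inl (ENNReal.rpow_ne_top_of_nonneg h1.le hfb)), ← hc] at key2
    have := mul_le_mul_left key2 c
    rwa [mul_assoc, mul_assoc (∫⁻ x, h x), ENNReal.inv_mul_cancel hc0 hct, mul_one, mul_one] at this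
  · intro t ht
    rcases lt_or_ge t 0 with h0 | h0
    · exact ⟨0, h0.trans_le toReal_nonneg⟩
    have : ENNReal.ofReal t * a < a := by
      have : ENNReal.ofReal t * a < 1 * a := by
        rw [ENNReal.mul_lt_mul_iff_left ha0 hfb]; simpa using ht
      simpa using this
    obtain ⟨x, hx⟩ := lt_iSup_iff.1 this
    refine ⟨x, ?_⟩
    rw [← ENNReal.ofReal_lt_iff_lt_toReal h0
      (ENNReal.div_ne_top (ne_top_of_le_ne_top hfb (hfa x)) ha0)]
    rwa [ENNReal.lt_div_iff_mul_lt (Or.inl ha0) (Or.inl hfb)]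
  · intro t ht
    rcases lt_or_ge t 0 with h0 | h0
    · exact ⟨0, h0.trans_le toReal_nonneg⟩
    have : ENNReal.ofReal t * b < b := by
      have : ENNReal.ofReal t * b < 1 * b := by
        rw [ENNReal.mul_lt_mul_iff_left hb0 hgb]; simpa using ht
      simpa using this
    obtain ⟨x, hx⟩ := lt_iSup_iff.1 this
    refine ⟨x, ?_⟩
    rw [← ENNReal.ofReal_lt_iff_lt_toReal h0
      (ENNReal.div_ne_top (ne_top_of_le_ne_top hgb (hgb' x)) hb0)]
    rwa [ENNReal.lt_div_iff_mul_lt (Or.inl hb0) (Or.inl hgb)]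
  · intro x y t ht0 htf htg
    rw [← ENNReal.ofReal_lt_iff_lt_toReal ht0.le
      (ENNReal.div_ne_top (ne_top_of_le_ne_top hfb (hfa x)) ha0)] at htf
    rw [← ENNReal.ofReal_lt_iff_lt_toReal ht0.le
      (ENNReal.div_ne_top (ne_top_of_le_ne_top hgb (hgb' y)) hb0)] at htg
    rw [← ENNReal.ofReal_lt_iff_lt_toReal ht0.le
      (ne_top_of_le_ne_top one_ne_top (min_le_right _ _)), lt_min_iff]
    have hf1 : f x / a ≤ 1 := ENNReal.div_le_of_le_mul (by simpa using hfa x)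
    refine ⟨?_, htf.trans_le hf1⟩
    have e : ENNReal.ofReal t = ENNReal.ofReal t ^ (1 - l) * ENNReal.ofReal t ^ l := by
      rw [← ENNReal.rpow_add _ _ (by simpa using ht0) (by simp)]; simp
    rw [e]
    refine (ENNReal.mul_lt_mul (ENNReal.rpow_lt_rpow htf h1)
      (ENNReal.rpow_lt_rpow htg hl0)).trans_le ?_
    rw [ENNReal.div_rpow_of_nonneg _ _ h1.le, ENNReal.div_rpow_of_nonneg _ _ hl0.le]
    refine le_trans (le_of_eq ?_) (ENNReal.div_le_div_right (H x y) c)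
    simp only [div_eq_mul_inv, hc]
    rw [mul_mul_mul_comm, ← ENNReal.mul_inv
        (Or.inr (ENNReal.rpow_ne_top_of_nonneg hl0.le hgb))
        (Or.inl (ENNReal.rpow_ne_top_of_nonneg h1.le hfb))]

open ENNReal in
/-- A measure on a real vector space satisfies the Prékopa-Leindler inequality. -/
def IsPrekopaLeindler {E : Type*} [AddCommGroup E] [Module ℝ E] [MeasurableSpace E]
    (μ : Measure E) : Prop :=
  ∀ f g h : E → ℝ≥0∞, Measurable f → Measurable g → Measurable h → ∀ l : ℝ, 0 < l → l < 1 →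
    (∀ x y, f x ^ (1 - l) * g y ^ l ≤ h ((1 - l) • x + l • y)) →
    (∫⁻ x, f x ∂μ) ^ (1 - l) * (∫⁻ x, g x ∂μ) ^ l ≤ ∫⁻ x, h x ∂μ

open ENNReal Filter Topology in
theorem isPrekopaLeindler_real : IsPrekopaLeindler (volume : Measure ℝ) := by
  intro f g h hf hg hh l hl0 hl1 H
  have h1 : 0 < 1 - l := sub_pos.2 hl1
  rcases eq_or_ne (∫⁻ x, f x) 0 with hf0 | hf0
  · simp [hf0, h1]
  rcases eq_or_ne (∫⁻ x, g x) 0 with hg0 | hg0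
  · simp [hg0, hl0]
  have lim : ∀ k : ℝ → ℝ≥0∞, Measurable k →
      Tendsto (fun n : ℕ => ∫⁻ x, min (k x) n) atTop (𝓝 (∫⁻ x, k x)) := by
    intro k hk
    refine lintegral_tendsto_of_tendsto_of_monotone (fun n => by fun_prop)
      (ae_of_all _ fun x n m hnm => min_le_min le_rfl (by exact_mod_cast hnm))
      (ae_of_all _ fun x => ?_)
    have := (tendsto_const_nhds (x := k x)).min (ENNReal.tendsto_nat_nhds_top)
    simpa using this
  have key : ∀ n : ℕ, (∫⁻ x, min (f x) n) ^ (1 - l) * (∫⁻ x, min (g x) n) ^ l ≤ ∫⁻ x, h x := by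
    intro n
    refine prekopa_leindler_real_of_bdd (by fun_prop) (by fun_prop) hh hl0 hl1
      (ne_top_of_le_ne_top (natCast_ne_top n) (iSup_le fun x => min_le_right _ _))
      (ne_top_of_le_ne_top (natCast_ne_top n) (iSup_le fun x => min_le_right _ _))
      fun x y => le_trans ?_ (H x y)
    gcongr
    · exact min_le_left _ _
    · exact min_le_left _ _
  refine le_of_tendsto' (ENNReal.Tendsto.mul ((lim f hf).ennrpow_const (1 - l)) (Or.inl ?_)
    ((lim g hg).ennrpow_const l) (Or.inl ?_)) key
  · simp [ENNReal.rpow_eq_zero_iff, hf0, h1.not_gt]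
  · simp [ENNReal.rpow_eq_zero_iff, hg0, hl0.not_gt]

theorem IsPrekopaLeindler.prod {E F : Type*} [AddCommGroup E] [Module ℝ E] [MeasurableSpace E]
    [AddCommGroup F] [Module ℝ F] [MeasurableSpace F] {μ : Measure E} {ν : Measure F}
    [SFinite ν] (hμ : IsPrekopaLeindler μ) (hν : IsPrekopaLeindler ν) :
    IsPrekopaLeindler (μ.prod ν) := by
  intro f g h hf hg hh l hl0 hl1 H
  rw [lintegral_prod _ hf.aemeasurable, lintegral_prod _ hg.aemeasurable,
    lintegral_prod _ hh.aemeasurable]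
  refine hμ _ _ _ hf.lintegral_prod_right' hg.lintegral_prod_right' hh.lintegral_prod_right'
    l hl0 hl1 fun x y => ?_
  exact hν _ _ _ (hf.comp measurable_prodMk_left) (hg.comp measurable_prodMk_left)
    (hh.comp measurable_prodMk_left) l hl0 hl1 fun s t => H (x, s) (y, t)

theorem IsPrekopaLeindler.of_measurePreserving {E F : Type*} [AddCommGroup E] [Module ℝ E]
    [MeasurableSpace E] [AddCommGroup F] [Module ℝ F] [MeasurableSpace F] {μ : Measure E}
    {ν : Measure F} (hμ : IsPrekopaLeindler μ) (e : E →ₗ[ℝ] F) (he : MeasurePreserving e μ ν) :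
    IsPrekopaLeindler ν := by
  intro f g h hf hg hh l hl0 hl1 H
  rw [← he.lintegral_comp hf, ← he.lintegral_comp hg, ← he.lintegral_comp hh]
  refine hμ _ _ _ (hf.comp he.measurable) (hg.comp he.measurable) (hh.comp he.measurable)
    l hl0 hl1 fun x y => ?_
  simpa using H (e x) (e y)

theorem isPrekopaLeindler_pi (n : ℕ) : IsPrekopaLeindler (volume : Measure (Fin n → ℝ)) := by
  induction n with
  | zero =>
    intro f g h hf hg hh l hl0 hl1 H
    have e : ∀ k : (Fin 0 → ℝ) → ENNReal, ∫⁻ x, k x = k 0 := by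
      intro k
      rw [volume_pi, Measure.pi_of_empty _ (0 : Fin 0 → ℝ)]
      exact lintegral_dirac _ _
    rw [e, e, e]
    simpa using H 0 0
  | succ n ih =>
    let e : (ℝ × (Fin n → ℝ)) →ₗ[ℝ] (Fin (n + 1) → ℝ) :=
      { toFun := fun p => Fin.cons p.1 p.2
        map_add' := fun p q => by
          ext i; refine Fin.cases ?_ (fun j => ?_) i <;> simp
        map_smul' := fun c p => by
          ext i; refine Fin.cases ?_ (fun j => ?_) i <;> simp }
    refine (isPrekopaLeindler_real.prod ih).of_measurePreserving e ?_
    have := (volume_preserving_piFinSuccAbove (fun _ : Fin (n + 1) => ℝ) 0).symm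
    have he : (e : ℝ × (Fin n → ℝ) → (Fin (n + 1) → ℝ)) =
        (MeasurableEquiv.piFinSuccAbove (fun _ : Fin (n + 1) => ℝ) 0).symm := by
      ext p i
      refine Fin.cases ?_ (fun j => ?_) i <;> simp [e, MeasurableEquiv.piFinSuccAbove]
    rw [he]
    exact this

section Gaussian

open ProbabilityTheory Filter Topology Set

/-- The standard Gaussian density. -/
noncomputable def gaussPDF (c : ℝ) : ℝ := (Real.sqrt (2 * Real.pi))⁻¹ * Real.exp (-c ^ 2 / 2)

theorem gaussPDF_pos (c : ℝ) : 0 < gaussPDF c := by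
  unfold gaussPDF; positivity

theorem continuous_gaussPDF : Continuous gaussPDF := by
  unfold gaussPDF; fun_prop

theorem gaussPDF_sub_eq (s x : ℝ) : gaussPDF (x - s) = gaussianPDFReal s 1 x := by
  simp [gaussPDF, gaussianPDFReal]

theorem gaussPDF_eq (x : ℝ) : gaussPDF x = gaussianPDFReal 0 1 x := by
  simpa using gaussPDF_sub_eq 0 x

theorem integrable_gaussPDF : Integrable gaussPDF := by
  rw [funext gaussPDF_eq]
  exact integrable_gaussianPDFReal 0 1

theorem gaussCDF_eq_integral (c : ℝ) : gaussCDF c = ∫ x in Iic c, gaussPDF x := by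
  simp only [gaussCDF, gaussPDF, integral_const_mul]

theorem gaussianReal_real_Iic_zero (c : ℝ) : (gaussianReal 0 1).real (Iic c) = gaussCDF c := by
  rw [gaussCDF_eq_integral, measureReal_def, gaussianReal_apply_eq_integral _ one_ne_zero,
    ENNReal.toReal_ofReal]
  · simp only [gaussPDF_eq]
  · exact integral_nonneg fun x => gaussianPDFReal_nonneg 0 1 x

theorem gaussianReal_real_Iic (s c : ℝ) : (gaussianReal s 1).real (Iic c) = gaussCDF (c - s) := by
  have h := gaussianReal_map_add_const (μ := 0) (v := 1) s
  rw [zero_add] at h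
  rw [← h, map_measureReal_apply (by fun_prop) measurableSet_Iic, ← gaussianReal_real_Iic_zero]
  congr 1
  ext x
  simp [le_sub_iff_add_le]

theorem gaussCDF_sub (a b : ℝ) : gaussCDF b - gaussCDF a = ∫ x in a..b, gaussPDF x := by
  rw [gaussCDF_eq_integral, gaussCDF_eq_integral]
  exact intervalIntegral.integral_Iic_sub_Iic integrable_gaussPDF.integrableOn
    integrable_gaussPDF.integrableOn

theorem hasDerivAt_gaussCDF (c : ℝ) : HasDerivAt gaussCDF (gaussPDF c) c := by
  have h : gaussCDF = fun b => gaussCDF 0 + ∫ x in (0 : ℝ)..b, gaussPDF x := by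
    ext b; rw [← gaussCDF_sub]; ring
  rw [h]
  exact (intervalIntegral.integral_hasDerivAt_right
    (continuous_gaussPDF.intervalIntegrable _ _)
    continuous_gaussPDF.stronglyMeasurable.stronglyMeasurableAtFilter
    continuous_gaussPDF.continuousAt).const_add _

theorem continuous_gaussCDF : Continuous gaussCDF :=
  continuous_iff_continuousAt.2 fun c => (hasDerivAt_gaussCDF c).continuousAt

theorem strictMono_gaussCDF : StrictMono gaussCDF :=
  strictMono_of_deriv_pos fun c => by
    rw [(hasDerivAt_gaussCDF c).deriv]; exact gaussPDF_pos c

theorem gaussCDF_eq_cdf : gaussCDF = cdf (gaussianReal 0 1) := by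
  ext c
  rw [cdf_eq_real, gaussianReal_real_Iic_zero]

theorem tendsto_gaussCDF_atBot : Tendsto gaussCDF atBot (𝓝 0) := by
  rw [gaussCDF_eq_cdf]; exact tendsto_cdf_atBot _

theorem tendsto_gaussCDF_atTop : Tendsto gaussCDF atTop (𝓝 1) := by
  rw [gaussCDF_eq_cdf]; exact tendsto_cdf_atTop _

theorem gaussCDF_pos (c : ℝ) : 0 < gaussCDF c :=
  (strictMono_gaussCDF.monotone.le_of_tendsto tendsto_gaussCDF_atBot (c - 1)).trans_lt
    (strictMono_gaussCDF (by linarith))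

theorem gaussCDF_lt_one (c : ℝ) : gaussCDF c < 1 :=
  (strictMono_gaussCDF (by linarith : c < c + 1)).trans_le
    (strictMono_gaussCDF.monotone.ge_of_tendsto tendsto_gaussCDF_atTop (c + 1))

theorem exists_gaussCDF_eq {θ : ℝ} (h0 : 0 < θ) (h1 : θ < 1) : ∃ c, gaussCDF c = θ := by
  have := mem_range_of_exists_le_of_exists_ge continuous_gaussCDF
    ((tendsto_gaussCDF_atBot.eventually (gt_mem_nhds h0)).exists.imp fun _ h => le_of_lt h)
    ((tendsto_gaussCDF_atTop.eventually (lt_mem_nhds h1)).exists.imp fun _ h => le_of_lt h)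
  exact this

theorem gaussCDF_neg (c : ℝ) : gaussCDF (-c) = 1 - gaussCDF c := by
  have h := gaussianReal_map_neg (μ := 0) (v := 1)
  rw [neg_zero] at h
  have h1 : gaussCDF (-c) = (gaussianReal 0 1).real (Ici c) := by
    rw [← gaussianReal_real_Iic_zero]
    nth_rw 1 [← h]
    rw [map_measureReal_apply (by fun_prop) measurableSet_Iic]
    congr 1
    ext x
    simp
  have := nullSingletonClass_gaussianReal (μ := 0) (v := 1) one_ne_zero
  rw [h1, ← gaussianReal_real_Iic_zero, ← probReal_compl_eq_one_sub measurableSet_Iic, compl_Iic]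
  exact measureReal_congr Ioi_ae_eq_Ici.symm

theorem gaussPDF_mul_le {x t r : ℝ} (hxt : x ≤ t) (hr : 0 ≤ r) :
    gaussPDF x * gaussPDF (t + r) ≤ gaussPDF (x + r) * gaussPDF t := by
  unfold gaussPDF
  rw [mul_mul_mul_comm, mul_mul_mul_comm _ (Real.exp (-(x + r) ^ 2 / 2)), ← Real.exp_add,
    ← Real.exp_add]
  gcongr ?_ * ?_
  rw [Real.exp_le_exp]
  nlinarith [mul_nonneg hr (sub_nonneg.2 hxt)]

theorem gaussCDF_add_eq (c r : ℝ) : gaussCDF (c + r) = ∫ x in Iic c, gaussPDF (x + r) := by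
  rw [gaussCDF_eq_integral, ← (measurePreserving_add_right volume r).setIntegral_preimage_emb
    (measurableEmbedding_addRight r)]
  congr 2
  ext x
  simp

/-- Log-concavity of the Gaussian distribution function. -/
theorem gaussCDF_mul_le {c c' r : ℝ} (hc : c ≤ c') (hr : 0 ≤ r) :
    gaussCDF (c' + r) * gaussCDF c ≤ gaussCDF (c + r) * gaussCDF c' := by
  have h1 : ∀ t, c ≤ t → gaussCDF c * gaussPDF (t + r) ≤ gaussCDF (c + r) * gaussPDF t := by
    intro t ht
    rw [gaussCDF_add_eq, gaussCDF_eq_integral, ← integral_mul_const, ← integral_mul_const]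
    refine setIntegral_mono_on (integrable_gaussPDF.mul_const _).integrableOn
      ((integrable_gaussPDF.comp_add_right r).mul_const _).integrableOn measurableSet_Iic
      fun x hx => gaussPDF_mul_le (le_trans hx ht) hr
  have h2 : gaussCDF (c' + r) - gaussCDF (c + r) = ∫ t in c..c', gaussPDF (t + r) := by
    rw [gaussCDF_sub, intervalIntegral.integral_comp_add_right]
  have h3 := gaussCDF_sub c c'
  have h4 : gaussCDF c * ∫ t in c..c', gaussPDF (t + r) ≤
      gaussCDF (c + r) * ∫ t in c..c', gaussPDF t := by
    rw [← intervalIntegral.integral_const_mul, ← intervalIntegral.integral_const_mul]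
    have := continuous_gaussPDF
    exact intervalIntegral.integral_mono_on hc
      (Continuous.intervalIntegrable (by fun_prop) _ _)
      (Continuous.intervalIntegrable (by fun_prop) _ _) fun t ht => h1 t ht.1
  rw [← h2, ← h3] at h4
  linarith

theorem hasDerivAt_gaussPDF (c : ℝ) : HasDerivAt gaussPDF (-c * gaussPDF c) c := by
  unfold gaussPDF
  have h : HasDerivAt (fun x : ℝ => -x ^ 2 / 2) (-c) c := by
    exact ((hasDerivAt_pow 2 c).neg.div_const 2).congr_deriv (by push_cast; ring)
  exact (h.exp.const_mul (Real.sqrt (2 * Real.pi))⁻¹).congr_deriv (by ring)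

theorem gaussPDF_le_one (c : ℝ) : gaussPDF c ≤ 1 := by
  unfold gaussPDF
  have h1 : 1 ≤ Real.sqrt (2 * Real.pi) := by
    rw [Real.one_le_sqrt]; linarith [Real.pi_gt_three]
  have h2 : Real.exp (-c ^ 2 / 2) ≤ 1 := by
    rw [Real.exp_le_one_iff]; nlinarith [sq_nonneg c]
  exact mul_le_one₀ (inv_le_one_of_one_le₀ h1) (Real.exp_pos _).le h2

theorem abs_mul_gaussPDF_le_one (c : ℝ) : |c| * gaussPDF c ≤ 1 := by
  unfold gaussPDF
  have h1 : 1 ≤ Real.sqrt (2 * Real.pi) := by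
    rw [Real.one_le_sqrt]; linarith [Real.pi_gt_three]
  have h2 : |c| * Real.exp (-c ^ 2 / 2) ≤ 1 := by
    have h3 : |c| ≤ Real.exp (c ^ 2 / 2) := by
      have := Real.add_one_le_exp (c ^ 2 / 2)
      nlinarith [sq_nonneg (|c| - 1), sq_abs c]
    rw [neg_div, Real.exp_neg, ← div_eq_mul_inv, div_le_one (Real.exp_pos _)]
    exact h3
  calc |c| * ((Real.sqrt (2 * Real.pi))⁻¹ * Real.exp (-c ^ 2 / 2))
      = (Real.sqrt (2 * Real.pi))⁻¹ * (|c| * Real.exp (-c ^ 2 / 2)) := by ring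
    _ ≤ 1 := mul_le_one₀ (inv_le_one_of_one_le₀ h1) (by positivity) h2

theorem gaussPDF_le_add {a b : ℝ} (hab : a ≤ b) : gaussPDF b ≤ gaussPDF a + (b - a) := by
  have := Convex.image_sub_le_mul_sub_of_deriv_le (f := gaussPDF) convex_univ
    continuous_gaussPDF.continuousOn
    (fun x _ => (hasDerivAt_gaussPDF x).differentiableAt.differentiableWithinAt) (C := 1)
    (fun x _ => by
      rw [(hasDerivAt_gaussPDF x).deriv]
      have := abs_mul_gaussPDF_le_one x
      nlinarith [neg_abs_le x, gaussPDF_pos x]) a (mem_univ _) b (mem_univ _) hab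
  linarith

theorem gaussCDF_add_le (c : ℝ) {r : ℝ} (hr : 0 ≤ r) :
    gaussCDF (c + r) ≤ gaussCDF c + r * gaussPDF c + r ^ 2 := by
  have h := gaussCDF_sub c (c + r)
  have h2 : ∫ x in c..(c + r), gaussPDF x ≤ ∫ x in c..(c + r), (gaussPDF c + r) := by
    refine intervalIntegral.integral_mono_on (by linarith)
      (continuous_gaussPDF.intervalIntegrable _ _) (by simp) fun x hx => ?_
    have := gaussPDF_le_add hx.1
    linarith [hx.2]
  rw [intervalIntegral.integral_const, smul_eq_mul] at h2
  nlinarith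

theorem gaussIsop_gaussCDF (c : ℝ) : gaussIsop (gaussCDF c) = gaussPDF c := by
  unfold gaussIsop gaussPDF
  rw [if_pos ⟨gaussCDF_pos c, gaussCDF_lt_one c⟩,
    Function.leftInverse_invFun strictMono_gaussCDF.injective]

theorem gaussIsop_nonneg (θ : ℝ) : 0 ≤ gaussIsop θ := by
  unfold gaussIsop; split_ifs <;> positivity

theorem gaussIsop_le_one (θ : ℝ) : gaussIsop θ ≤ 1 := by
  unfold gaussIsop
  split_ifs
  · exact gaussPDF_le_one _
  · exact zero_le_one

theorem gaussPDF_neg (c : ℝ) : gaussPDF (-c) = gaussPDF c := by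
  simp [gaussPDF]

theorem exists_gaussPDF_lt {ε : ℝ} (hε : 0 < ε) : ∃ b, ∀ c ≤ b, gaussPDF c < ε := by
  refine ⟨-(2 / ε), fun c hc => ?_⟩
  have h := abs_mul_gaussPDF_le_one c
  have h2 : 2 / ε ≤ |c| := by rw [le_abs]; right; linarith
  have h3 : 2 / ε * gaussPDF c ≤ 1 :=
    (mul_le_mul_of_nonneg_right h2 (gaussPDF_pos c).le).trans h
  rw [div_mul_eq_mul_div, div_le_one hε] at h3
  linarith [gaussPDF_pos c]

theorem continuous_gaussIsop : Continuous gaussIsop := by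
  have key : ∀ ε > 0, ∃ b, ∀ θ, (θ < gaussCDF b ∨ 1 - gaussCDF b < θ) → gaussIsop θ < ε := by
    intro ε hε
    obtain ⟨b, hb⟩ := exists_gaussPDF_lt hε
    refine ⟨b, fun θ hθ => ?_⟩
    by_cases h01 : θ ∈ Ioo (0 : ℝ) 1
    · obtain ⟨c, rfl⟩ := exists_gaussCDF_eq h01.1 h01.2
      rw [gaussIsop_gaussCDF]
      rcases hθ with h | h
      · exact hb c (strictMono_gaussCDF.lt_iff_lt.1 h).le
      · rw [← gaussCDF_neg, strictMono_gaussCDF.lt_iff_lt] at h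
        rw [← gaussPDF_neg]
        exact hb _ (by linarith)
    · rw [gaussIsop, if_neg h01]; exact hε
  have zero : ∀ {θ}, gaussIsop θ = 0 →
      (∀ b, ∀ᶠ t in 𝓝 θ, t < gaussCDF b ∨ 1 - gaussCDF b < t) → ContinuousAt gaussIsop θ := by
    intro θ h0 h
    rw [ContinuousAt, h0, Metric.tendsto_nhds]
    intro ε hε
    obtain ⟨b, hb⟩ := key ε hε
    filter_upwards [h b] with t ht
    rw [Real.dist_eq, sub_zero, abs_of_nonneg (gaussIsop_nonneg t)]
    exact hb t ht
  rw [continuous_iff_continuousAt]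
  intro θ
  rcases le_or_gt θ 0 with h0 | h0
  · exact zero (if_neg fun h => h0.not_gt h.1) fun b =>
      (gt_mem_nhds (h0.trans_lt (gaussCDF_pos b))).mono fun _ h => Or.inl h
  rcases le_or_gt 1 θ with h1 | h1
  · exact zero (if_neg fun h => h1.not_gt h.2) fun b =>
      (lt_mem_nhds (by linarith [gaussCDF_pos b])).mono fun _ h => Or.inr h
  obtain ⟨c, rfl⟩ := exists_gaussCDF_eq h0 h1
  have hs : HasStrictDerivAt gaussCDF (gaussPDF c) c :=
    hasStrictDerivAt_of_hasDerivAt_of_continuousAt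
      (Eventually.of_forall hasDerivAt_gaussCDF) continuous_gaussPDF.continuousAt
  rw [ContinuousAt, ← hs.map_nhds_eq (gaussPDF_pos c).ne', tendsto_map'_iff, gaussIsop_gaussCDF]
  exact (continuous_gaussPDF.tendsto c).congr fun t => (gaussIsop_gaussCDF t).symm

end Gaussian

section RealLine

open ProbabilityTheory Filter Topology Set Metric
open scoped ENNReal

/-- The measure with density `exp ((t - s) ^ 2 / 2)` relative to `ν`. -/
noncomputable def gaussTilt (ν : Measure ℝ) (s : ℝ) : Measure ℝ :=
  ν.withDensity fun t => ENNReal.ofReal (Real.exp ((t - s) ^ 2 / 2))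

/-- The mass of a ball of fixed radius is a quasi-concave function of its center. -/
def IsBallQuasiconcave (σ : Measure ℝ) : Prop :=
  ∀ x y z h : ℝ, x ≤ y → y ≤ z → 0 < h →
    min (σ (closedBall x h)) (σ (closedBall z h)) ≤ σ (closedBall y h)

theorem IsBallQuasiconcave.exists_rnDeriv {σ : Measure ℝ} [IsLocallyFiniteMeasure σ]
    (hσ : IsBallQuasiconcave σ) :
    ∀ᵐ y, ∀ᵐ x, ∀ᵐ z, x ≤ y → y ≤ z →
      min (σ.rnDeriv volume x) (σ.rnDeriv volume z) ≤ σ.rnDeriv volume y := by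
  have h := Besicovitch.ae_tendsto_rnDeriv σ (volume : Measure ℝ)
  filter_upwards [h] with y hy
  filter_upwards [h] with x hx
  filter_upwards [h] with z hz hxy hyz
  refine le_of_tendsto_of_tendsto (hx.min hz) hy ?_
  filter_upwards [self_mem_nhdsWithin] with r hr
  simp only [Real.volume_closedBall]
  rw [min_le_iff]
  exact (min_le_iff.1 (hσ x y z r hxy hyz hr)).imp (fun h => ENNReal.div_le_div_right h _)
    fun h => ENNReal.div_le_div_right h _

theorem gaussTilt_withDensity (ν : Measure ℝ) [SFinite ν] (s : ℝ) :
    (gaussTilt ν s).withDensity (fun t => ENNReal.ofReal (Real.exp (-(t - s) ^ 2 / 2))) = ν := by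
  rw [gaussTilt, ← withDensity_mul _ (by fun_prop) (by fun_prop)]
  convert withDensity_one
  ext t
  simp only [Pi.mul_apply, Pi.one_apply]
  rw [← ENNReal.ofReal_mul (Real.exp_pos _).le, ← Real.exp_add]
  simp [neg_div]

theorem gaussianReal_apply_eq (s : ℝ) (S : Set ℝ) :
    gaussianReal s 1 S = ENNReal.ofReal (Real.sqrt (2 * Real.pi))⁻¹ *
      ∫⁻ t in S, ENNReal.ofReal (Real.exp (-(t - s) ^ 2 / 2)) := by
  rw [gaussianReal_apply _ one_ne_zero, ← lintegral_const_mul _ (by fun_prop)]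
  congr with t
  rw [gaussianPDF, ← gaussPDF_sub_eq, gaussPDF, ENNReal.ofReal_mul (by positivity)]

theorem gaussCDF_add_le_of_isBallQuasiconcave {ν : Measure ℝ} [IsProbabilityMeasure ν]
    (hν : ν ≪ volume) (hq : ∀ s, IsBallQuasiconcave (gaussTilt ν s)) {a b r : ℝ}
    (hab : ν.real (Iic a) = gaussCDF b) (hr : 0 ≤ r) :
    gaussCDF (b + r) ≤ ν.real (Iic (a + r)) := by
  set s := a - b with hs
  set σ := gaussTilt ν s with hσ
  set w : ℝ → ℝ≥0∞ := fun t => ENNReal.ofReal (Real.exp (-(t - s) ^ 2 / 2)) with hw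
  set c := ENNReal.ofReal (Real.sqrt (2 * Real.pi))⁻¹ with hc
  have hwm : Measurable w := by fun_prop
  have hlf : IsLocallyFiniteMeasure σ :=
    IsLocallyFiniteMeasure.withDensity_ofReal (by fun_prop)
  have hσv : σ ≪ volume := (withDensity_absolutelyContinuous _ _).trans hν
  set ρ := σ.rnDeriv volume with hρ
  have hνw : ∀ S, ν S = ∫⁻ t in S, ρ t * w t := by
    intro S
    have h1 : ν = (volume.withDensity ρ).withDensity w := by
      rw [Measure.withDensity_rnDeriv_eq _ _ hσv, gaussTilt_withDensity]
    rw [← withDensity_mul _ (Measure.measurable_rnDeriv _ _) hwm] at h1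
    conv_lhs => rw [h1]
    rw [withDensity_apply' _ S]
    rfl
  have hγ : ∀ S, gaussianReal s 1 S = ∫⁻ t in S, c * w t := by
    intro S
    rw [gaussianReal_apply_eq, lintegral_const_mul _ hwm]
  have hmono : ∀ S, MeasurableSet S → (∀ᵐ t, t ∈ S → ρ t < c) → ν S ≤ gaussianReal s 1 S := by
    intro S hS h
    rw [hνw, hγ]
    refine setLIntegral_mono_ae' hS ?_
    filter_upwards [h] with t ht hts
    gcongr
    exact (ht hts).le
  have hmono' : ∀ S, MeasurableSet S → (∀ᵐ t, t ∈ S → ¬ ρ t < c) → gaussianReal s 1 S ≤ ν S := by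
    intro S hS h
    rw [hνw, hγ]
    refine setLIntegral_mono_ae' hS ?_
    filter_upwards [h] with t ht hts
    gcongr
    exact not_lt.1 (ht hts)
  by_contra! hlt
  rw [show b + r = a + r - s by rw [hs]; ring, ← gaussianReal_real_Iic] at hlt
  have hab' : ν.real (Iic a) = (gaussianReal s 1).real (Iic a) := by
    rw [hab, gaussianReal_real_Iic]; congr 1; rw [hs]; ring
  have h1 : ν.real (Ioc a (a + r)) < (gaussianReal s 1).real (Ioc a (a + r)) := by
    have e : ∀ m : Measure ℝ, IsProbabilityMeasure m →
        m.real (Iic (a + r)) = m.real (Iic a) + m.real (Ioc a (a + r)) := fun m hm => by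
      rw [← measureReal_union (by
        rw [Set.disjoint_left]; intro x hx hx'; exact hx'.1.not_ge hx) measurableSet_Ioc,
        Iic_union_Ioc_eq_Iic (by linarith)]
    rw [e ν inferInstance, e (gaussianReal s 1) inferInstance, hab'] at hlt
    linarith
  have h2 : (gaussianReal s 1).real (Ioi (a + r)) < ν.real (Ioi (a + r)) := by
    rw [← compl_Iic, probReal_compl_eq_one_sub measurableSet_Iic,
      probReal_compl_eq_one_sub measurableSet_Iic]
    linarith
  have toReal : ∀ {m m' : Measure ℝ} {S : Set ℝ}, IsProbabilityMeasure m' →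
      m S ≤ m' S → m.real S ≤ m'.real S := fun _ h => ENNReal.toReal_mono (measure_ne_top _ _) h
  obtain ⟨y, hyI, hyc, hy⟩ : ∃ y, y ∈ Ioc a (a + r) ∧ ρ y < c ∧ ∀ᵐ x, ∀ᵐ z, x ≤ y → y ≤ z →
      min (ρ x) (ρ z) ≤ ρ y := by
    by_contra hne
    refine h1.not_ge (toReal inferInstance (hmono' _ measurableSet_Ioc ?_))
    filter_upwards [(hq s).exists_rnDeriv] with t ht hts htc
    exact hne ⟨t, hts, htc, ht⟩
  obtain ⟨x, hxI, hxy, hx⟩ : ∃ x, x ∈ Iic a ∧ ρ y < ρ x ∧ ∀ᵐ z, x ≤ y → y ≤ z →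
      min (ρ x) (ρ z) ≤ ρ y := by
    by_contra hne
    have hle : ν (Iic a) ≤ ρ y * ∫⁻ t in Iic a, w t := by
      rw [hνw, ← lintegral_const_mul _ hwm]
      refine setLIntegral_mono_ae' measurableSet_Iic ?_
      filter_upwards [hy] with t ht hts
      gcongr
      by_contra! hcon
      exact hne ⟨t, hts, hcon, ht⟩
    have hpos : gaussianReal s 1 (Iic a) ≠ 0 := by
      intro h0
      have := gaussCDF_pos b
      rw [← hab, hab', measureReal_def, h0] at this
      simp at this
    rw [← (measureReal_eq_measureReal_iff (by finiteness) (by finiteness)).1 hab'.symm] at hle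
    rw [hγ, lintegral_const_mul _ hwm] at hle hpos
    have hfin : c * ∫⁻ t in Iic a, w t ≠ ⊤ := by
      rw [← lintegral_const_mul _ hwm, ← hγ]; finiteness
    have hc0 : c ≠ 0 := by rw [hc]; simp; positivity
    refine hle.not_gt (ENNReal.mul_lt_mul_left (right_ne_zero_of_mul hpos) ?_ hyc)
    intro ht
    rw [ht, ENNReal.mul_top hc0] at hfin
    exact hfin rfl
  obtain ⟨z, hzI, hzc, hz⟩ : ∃ z, z ∈ Ioi (a + r) ∧ ¬ ρ z < c ∧ (x ≤ y → y ≤ z →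
      min (ρ x) (ρ z) ≤ ρ y) := by
    by_contra! hne
    refine h2.not_ge (toReal inferInstance (hmono _ measurableSet_Ioi ?_))
    filter_upwards [hx] with t ht hts
    by_contra! htc
    obtain ⟨h1, h2, h3⟩ := hne t hts htc
    exact h3.not_ge (ht h1 h2)
  have := hz (hxI.trans hyI.1.le) (hyI.2.trans hzI.le)
  rcases min_le_iff.1 this with h | h
  · exact hxy.not_ge h
  · exact hzc (h.trans_lt hyc)

/-- Left half-lines, hence by complementation right half-lines, grow at least as fast under `ν`
as under the Gaussian measure. -/
def HalfLineComparison (ν : Measure ℝ) : Prop :=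
  ∀ a b r : ℝ, 0 ≤ r → ν.real (Iic a) = gaussCDF b → gaussCDF (b + r) ≤ ν.real (Iic (a + r))

theorem HalfLineComparison.le_Iio {ν : Measure ℝ} [IsProbabilityMeasure ν] [NullSingletonClass ν]
    (hL : HalfLineComparison ν) {a d r : ℝ} (hr : 0 ≤ r) (hd : ν.real (Iic a) ≤ gaussCDF d) :
    gaussCDF (d + r) * ν.real (Iic a) ≤ ν.real (Iio (a + r)) * gaussCDF d := by
  rw [measureReal_congr (Iio_ae_eq_Iic (a := a + r))]
  rcases eq_or_lt_of_le (measureReal_nonneg (μ := ν) (s := Iic a)) with h0 | h0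
  · rw [← h0, mul_zero]
    exact mul_nonneg measureReal_nonneg (gaussCDF_pos d).le
  obtain ⟨b, hb⟩ := exists_gaussCDF_eq h0 (hd.trans_lt (gaussCDF_lt_one d))
  rw [← hb] at hd ⊢
  refine (gaussCDF_mul_le (strictMono_gaussCDF.le_iff_le.1 hd) hr).trans ?_
  exact mul_le_mul_of_nonneg_right (hL a b r hr hb.symm) (gaussCDF_pos d).le

theorem HalfLineComparison.le_Ioi {ν : Measure ℝ} [IsProbabilityMeasure ν] [NullSingletonClass ν]
    (hL : HalfLineComparison ν) {a d r : ℝ} (hr : 0 ≤ r) (hd : ν.real (Ici a) ≤ gaussCDF d) :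
    gaussCDF (d + r) * ν.real (Ici a) ≤ ν.real (Ioi (a - r)) * gaussCDF d := by
  rcases eq_or_lt_of_le (measureReal_nonneg (μ := ν) (s := Ici a)) with h0 | h0
  · rw [← h0, mul_zero]
    exact mul_nonneg measureReal_nonneg (gaussCDF_pos d).le
  obtain ⟨b, hb⟩ := exists_gaussCDF_eq h0 (hd.trans_lt (gaussCDF_lt_one d))
  rw [← hb] at hd ⊢
  refine (gaussCDF_mul_le (strictMono_gaussCDF.le_iff_le.1 hd) hr).trans ?_
  refine mul_le_mul_of_nonneg_right ?_ (gaussCDF_pos d).le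
  have ha : ν.real (Iic a) = gaussCDF (-b) := by
    rw [gaussCDF_neg, hb, ← measureReal_congr (Iio_ae_eq_Iic (a := a)), ← compl_Ici,
      probReal_compl_eq_one_sub measurableSet_Ici]
  rw [← compl_Iic, probReal_compl_eq_one_sub measurableSet_Iic]
  by_contra! hlt
  have h1 : gaussCDF (-(b + r)) < ν.real (Iic (a - r)) := by rw [gaussCDF_neg]; linarith
  have h2 : ν.real (Iic (a - r)) ≤ ν.real (Iic a) :=
    measureReal_mono (Iic_subset_Iic.2 (by linarith))
  obtain ⟨e, he⟩ := exists_gaussCDF_eq ((gaussCDF_pos _).trans h1)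
    (h2.trans_lt (ha ▸ gaussCDF_lt_one _))
  have h3 := hL (a - r) e r hr he.symm
  rw [sub_add_cancel, ha, strictMono_gaussCDF.le_iff_le] at h3
  rw [← he, strictMono_gaussCDF.lt_iff_lt] at h1
  linarith

theorem connectedComponentIn_eq_of_Icc_subset {S : Set ℝ} {x y : ℝ} (h : uIcc x y ⊆ S) :
    y ∈ connectedComponentIn S x :=
  isPreconnected_uIcc.subset_connectedComponentIn left_mem_uIcc h right_mem_uIcc

theorem exists_Iic_of_compl_component {B : Set ℝ} (hB : IsClosed B) {x : ℝ} (hx : x ∉ B) :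
    Iic x \ connectedComponentIn Bᶜ x = ∅ ∨
      ∃ l ∈ B, Iic x \ connectedComponentIn Bᶜ x = Iic l := by
  set J := connectedComponentIn Bᶜ x with hJ
  have hJo : IsOpen J := hB.isOpen_compl.connectedComponentIn
  have hJc : J.OrdConnected := isPreconnected_connectedComponentIn.ordConnected
  have hxJ : x ∈ J := mem_connectedComponentIn hx
  rcases (Iic x \ J).eq_empty_or_nonempty with h | h
  · exact Or.inl h
  right
  have hcl : IsClosed (Iic x \ J) := isClosed_Iic.sdiff hJo
  have hbdd : BddAbove (Iic x \ J) := ⟨x, fun y hy => hy.1⟩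
  have hl := hcl.csSup_mem h hbdd
  set l := sSup (Iic x \ J)
  refine ⟨l, ?_, ?_⟩
  · by_contra hlB
    refine hl.2 (connectedComponentIn_eq_of_Icc_subset fun y hy => ?_)
    rw [uIcc_of_ge hl.1] at hy
    rcases eq_or_lt_of_le hy.1 with h | h
    · exact h ▸ hlB
    · by_contra hyB
      exact h.not_ge (le_csSup hbdd ⟨hy.2, fun hyJ => hyB (connectedComponentIn_subset _ _ hyJ)⟩)
  · ext y
    refine ⟨fun hy => le_csSup hbdd hy, fun hy => ⟨le_trans (mem_Iic.1 hy) hl.1, fun hyJ => ?_⟩⟩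
    exact hl.2 (hJc.out hyJ hxJ ⟨hy, hl.1⟩)

theorem exists_Ici_of_compl_component {B : Set ℝ} (hB : IsClosed B) {x : ℝ} (hx : x ∉ B) :
    Ici x \ connectedComponentIn Bᶜ x = ∅ ∨
      ∃ l ∈ B, Ici x \ connectedComponentIn Bᶜ x = Ici l := by
  set J := connectedComponentIn Bᶜ x with hJ
  have hJo : IsOpen J := hB.isOpen_compl.connectedComponentIn
  have hJc : J.OrdConnected := isPreconnected_connectedComponentIn.ordConnected
  have hxJ : x ∈ J := mem_connectedComponentIn hx
  rcases (Ici x \ J).eq_empty_or_nonempty with h | h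
  · exact Or.inl h
  right
  have hcl : IsClosed (Ici x \ J) := isClosed_Ici.sdiff hJo
  have hbdd : BddBelow (Ici x \ J) := ⟨x, fun y hy => hy.1⟩
  have hl := hcl.csInf_mem h hbdd
  set l := sInf (Ici x \ J)
  refine ⟨l, ?_, ?_⟩
  · by_contra hlB
    refine hl.2 (connectedComponentIn_eq_of_Icc_subset fun y hy => ?_)
    rw [uIcc_of_le hl.1] at hy
    rcases eq_or_lt_of_le hy.2 with h | h
    · exact h ▸ hlB
    · by_contra hyB
      exact h.not_ge (csInf_le hbdd ⟨hy.1, fun hyJ => hyB (connectedComponentIn_subset _ _ hyJ)⟩)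
  · ext y
    refine ⟨fun hy => csInf_le hbdd hy, fun hy => ⟨le_trans hl.1 (mem_Ici.1 hy), fun hyJ => ?_⟩⟩
    exact hl.2 (hJc.out hxJ hyJ ⟨hl.1, hy⟩)

theorem measureReal_component_diff_thickening_le {ν : Measure ℝ} [IsProbabilityMeasure ν]
    [NullSingletonClass ν] (hL : HalfLineComparison ν) {B : Set ℝ} (hB : IsClosed B)
    {x r d : ℝ} (hr : 0 ≤ r) (hx : x ∉ B)
    (hd : ν.real (connectedComponentIn Bᶜ x) = gaussCDF d) :
    ν.real (connectedComponentIn Bᶜ x \ thickening r B) ≤ gaussCDF (d - r) := by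
  set J := connectedComponentIn Bᶜ x with hJ
  have hJo : IsOpen J := hB.isOpen_compl.connectedComponentIn
  have hxJ : x ∈ J := mem_connectedComponentIn hx
  set L := Iic x \ J
  set U := Ici x \ J
  have hLU : ν.real L + ν.real U = gaussCDF (-d) := by
    rw [gaussCDF_neg, ← hd, ← probReal_compl_eq_one_sub hJo.measurableSet,
      ← measureReal_union _ (measurableSet_Ici.diff hJo.measurableSet), ← union_sdiff_distrib,
      Iic_union_Ici, compl_eq_univ_sdiff]
    rw [Set.disjoint_left]
    rintro y ⟨hy, hyJ⟩ ⟨hy', -⟩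
    exact hyJ (le_antisymm (mem_Iic.1 hy) (mem_Ici.1 hy') ▸ hxJ)
  obtain ⟨L', hL'm, hL'low, hL'B, hL'⟩ : ∃ L' : Set ℝ, MeasurableSet L' ∧ IsLowerSet L' ∧
      L' ∩ J ⊆ thickening r B ∧
      gaussCDF (-d + r) * ν.real L ≤ ν.real L' * gaussCDF (-d) := by
    rcases exists_Iic_of_compl_component hB hx with h | ⟨l, hlB, h⟩
    · refine ⟨∅, MeasurableSet.empty, isLowerSet_empty, by simp, ?_⟩
      simp only [L, J, h]; simp
    · refine ⟨Iio (l + r), measurableSet_Iio, isLowerSet_Iio _, ?_, ?_⟩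
      · rintro y ⟨hy, hyJ⟩
        rw [mem_thickening_iff]
        refine ⟨l, hlB, ?_⟩
        have hly : l < y := by
          by_contra! hyl
          exact (h.ge hyl).2 hyJ
        rw [Real.dist_eq, abs_of_pos (by linarith)]
        linarith [mem_Iio.1 hy]
      · have e : L = Iic l := h
        rw [e] at hLU ⊢
        exact hL.le_Iio hr (by linarith [measureReal_nonneg (μ := ν) (s := U)])
  obtain ⟨U', hU'm, hU'up, hU'B, hU'⟩ : ∃ U' : Set ℝ, MeasurableSet U' ∧ IsUpperSet U' ∧
      U' ∩ J ⊆ thickening r B ∧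
      gaussCDF (-d + r) * ν.real U ≤ ν.real U' * gaussCDF (-d) := by
    rcases exists_Ici_of_compl_component hB hx with h | ⟨l, hlB, h⟩
    · refine ⟨∅, MeasurableSet.empty, isUpperSet_empty, by simp, ?_⟩
      simp only [U, J, h]; simp
    · refine ⟨Ioi (l - r), measurableSet_Ioi, isUpperSet_Ioi _, ?_, ?_⟩
      · rintro y ⟨hy, hyJ⟩
        rw [mem_thickening_iff]
        refine ⟨l, hlB, ?_⟩
        have hly : y < l := by
          by_contra! hyl
          exact (h.ge hyl).2 hyJ
        rw [Real.dist_eq, abs_of_neg (by linarith)]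
        linarith [mem_Ioi.1 hy]
      · have e : U = Ici l := h
        rw [e] at hLU ⊢
        exact hL.le_Ioi hr (by linarith [measureReal_nonneg (μ := ν) (s := L)])
  have hsub : J \ thickening r B ⊆ (L' ∪ U')ᶜ := by
    rintro y ⟨hyJ, hyB⟩ (hy | hy)
    · exact hyB (hL'B ⟨hy, hyJ⟩)
    · exact hyB (hU'B ⟨hy, hyJ⟩)
  by_cases hdisj : Disjoint L' U'
  · refine (measureReal_mono hsub).trans ?_
    rw [probReal_compl_eq_one_sub (hL'm.union hU'm), measureReal_union hdisj hU'm]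
    have h1 : gaussCDF (-d + r) ≤ ν.real L' + ν.real U' := by
      have := gaussCDF_pos (-d)
      refine le_of_mul_le_mul_right ?_ this
      calc gaussCDF (-d + r) * gaussCDF (-d) = gaussCDF (-d + r) * (ν.real L + ν.real U) := by
            rw [hLU]
        _ ≤ _ := by linarith
    rw [show d - r = -(-d + r) by ring, gaussCDF_neg]
    linarith
  · obtain ⟨y, hyL, hyU⟩ := Set.not_disjoint_iff.1 hdisj
    have : L' ∪ U' = univ := by
      ext z
      simp only [mem_union, mem_univ, iff_true]
      rcases le_total z y with h | h
      · exact Or.inl (hL'low h hyL)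
      · exact Or.inr (hU'up h hyU)
    rw [this, compl_univ, subset_empty_iff] at hsub
    rw [hsub, measureReal_empty]
    exact (gaussCDF_pos _).le

theorem HalfLineComparison.le_thickening {ν : Measure ℝ} [IsProbabilityMeasure ν]
    [NullSingletonClass ν] (hL : HalfLineComparison ν) {B : Set ℝ} (hB : IsClosed B)
    {c r : ℝ} (hr : 0 < r) (hc : ν.real B = gaussCDF c) :
    gaussCDF (c + r) ≤ ν.real (thickening r B) := by
  set S : Set (Set ℝ) := (connectedComponentIn Bᶜ) '' Bᶜ with hS
  have hcompl : ν.real Bᶜ = gaussCDF (-c) := by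
    rw [gaussCDF_neg, ← hc, probReal_compl_eq_one_sub hB.measurableSet]
  have hopen : ∀ J ∈ S, IsOpen J := by
    rintro _ ⟨x, -, rfl⟩
    exact hB.isOpen_compl.connectedComponentIn
  have hdisj : S.PairwiseDisjoint id := by
    rintro _ ⟨x, hx, rfl⟩ _ ⟨y, hy, rfl⟩ hne
    rw [Function.onFun, id, id, Set.disjoint_left]
    intro z hz hz'
    exact hne ((connectedComponentIn_eq hz).trans (connectedComponentIn_eq hz').symm)
  have hcount : S.Countable := by
    refine hdisj.countable_of_isOpen hopen ?_
    rintro _ ⟨x, hx, rfl⟩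
    exact ⟨x, mem_connectedComponentIn hx⟩
  have hU : ⋃₀ S = Bᶜ := by
    refine Subset.antisymm (sUnion_subset ?_) fun x hx =>
      mem_sUnion.2 ⟨_, ⟨x, hx, rfl⟩, mem_connectedComponentIn hx⟩
    rintro _ ⟨x, hx, rfl⟩
    exact connectedComponentIn_subset _ _
  set k := gaussCDF (-c - r) / gaussCDF (-c) with hk
  have hk0 : 0 ≤ k := div_nonneg (gaussCDF_pos _).le (gaussCDF_pos _).le
  have hgap : ∀ J ∈ S, ν (J \ thickening r B) ≤ ENNReal.ofReal k * ν J := by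
    rintro _ ⟨x, hx, rfl⟩
    rcases eq_or_lt_of_le (measureReal_nonneg (μ := ν) (s := connectedComponentIn Bᶜ x))
      with h0 | h0
    · have : ν (connectedComponentIn Bᶜ x) = 0 := (measureReal_eq_zero_iff (by finiteness)).1 h0.symm
      rw [measure_mono_null sdiff_subset this]
      exact zero_le
    have hle : ν.real (connectedComponentIn Bᶜ x) ≤ gaussCDF (-c) :=
      hcompl ▸ measureReal_mono (connectedComponentIn_subset _ _)
    obtain ⟨d, hd⟩ := exists_gaussCDF_eq h0 (hle.trans_lt (gaussCDF_lt_one _))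
    have h1 := measureReal_component_diff_thickening_le hL hB hr.le hx hd.symm
    have h2 : gaussCDF (d - r) ≤ k * gaussCDF d := by
      rw [hk, div_mul_eq_mul_div, le_div_iff₀ (gaussCDF_pos _)]
      rw [← hd, strictMono_gaussCDF.le_iff_le] at hle
      have := gaussCDF_mul_le (sub_le_sub_right hle r) hr.le
      rw [sub_add_cancel, sub_add_cancel] at this
      linarith
    rw [hd] at h2
    have h3 := ENNReal.ofReal_le_ofReal (h1.trans h2)
    rwa [ENNReal.ofReal_mul hk0, ofReal_measureReal, ofReal_measureReal] at h3
  have hmain : ν (thickening r B)ᶜ ≤ ENNReal.ofReal k * ν Bᶜ := by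
    have hsub : (thickening r B)ᶜ ⊆ ⋃ J ∈ S, J \ thickening r B := by
      intro x hx
      have hxB : x ∈ Bᶜ := fun h => hx (self_subset_thickening hr B h)
      exact mem_iUnion₂.2 ⟨_, ⟨x, hxB, rfl⟩, mem_connectedComponentIn hxB, hx⟩
    have : Countable S := hcount
    calc ν (thickening r B)ᶜ ≤ ν (⋃ J ∈ S, J \ thickening r B) := measure_mono hsub
      _ ≤ ∑' J : S, ν ((J : Set ℝ) \ thickening r B) := measure_biUnion_le ν hcount _
      _ ≤ ∑' J : S, ENNReal.ofReal k * ν J := ENNReal.tsum_le_tsum fun J => hgap J J.2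
      _ = ENNReal.ofReal k * ν Bᶜ := by
        rw [ENNReal.tsum_mul_left, ← measure_sUnion hcount hdisj fun J hJ => (hopen J hJ).measurableSet,
          hU]
  have h4 := ENNReal.toReal_mono (by finiteness) hmain
  rw [ENNReal.toReal_mul, ENNReal.toReal_ofReal hk0, ← measureReal_def, ← measureReal_def, hcompl,
    hk, div_mul_cancel₀ _ (gaussCDF_pos _).ne', probReal_compl_eq_one_sub
      isOpen_thickening.measurableSet, show -c - r = -(c + r) by ring, gaussCDF_neg] at h4
  linarith

end RealLine

section Bisection

open Filter Topology Set

variable {E : Type*} [NormedAddCommGroup E] [NormedSpace ℝ E] [MeasurableSpace E] [BorelSpace E]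

/-- Affine hyperplanes are null sets. -/
def NullHyperplanes (μ : Measure E) : Prop :=
  ∀ ℓ : E →L[ℝ] ℝ, ℓ ≠ 0 → ∀ c, μ {x | ℓ x = c} = 0

/-- A compact convex set whose mass is divided by `A` in the exact proportion `θ`, and in which `B`
has proportion less than `θ'`. -/
structure IsNeedle (μ : Measure E) (A B : Set E) (θ θ' : ℝ) (C : Set E) : Prop where
  isCompact : IsCompact C
  convex : Convex ℝ C
  measure_inter_left : μ.real (A ∩ C) = θ * μ.real C
  measure_inter_right : μ.real (B ∩ C) < θ' * μ.real C

variable {μ : Measure E} [IsFiniteMeasure μ] {A B C : Set E} {θ θ' : ℝ}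

theorem continuous_measureReal_rotating_halfSpace (hμ : NullHyperplanes μ) {S : Set E}
    (hS : MeasurableSet S) {ℓ₁ ℓ₂ : E →L[ℝ] ℝ}
    (hℓ : ∀ a b : ℝ, a • ℓ₁ + b • ℓ₂ = 0 → a = 0 ∧ b = 0) (p₁ p₂ : ℝ) :
    Continuous fun t : ℝ => μ.real
      (S ∩ {x | 0 ≤ Real.cos t * (ℓ₁ x - p₁) + Real.sin t * (ℓ₂ x - p₂)}) := by
  classical
  have hm : ∀ t : ℝ, MeasurableSet
      (S ∩ {x | 0 ≤ Real.cos t * (ℓ₁ x - p₁) + Real.sin t * (ℓ₂ x - p₂)}) := fun t =>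
    hS.inter (measurableSet_le measurable_const (by fun_prop))
  simp_rw [← fun t => integral_indicator_one (μ := μ) (hm t)]
  rw [continuous_iff_continuousAt]
  intro t
  refine continuousAt_of_dominated (bound := fun _ => 1)
    (Eventually.of_forall fun t => (measurable_one.indicator (hm t)).aestronglyMeasurable)
    (Eventually.of_forall fun t => Eventually.of_forall fun x => ?_) (integrable_const _) ?_
  · rw [indicator_apply]; split_ifs <;> simp
  have hne : Real.cos t • ℓ₁ + Real.sin t • ℓ₂ ≠ 0 := fun h => by
    obtain ⟨h1, h2⟩ := hℓ _ _ h
    have := Real.sin_sq_add_cos_sq t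
    rw [h1, h2] at this
    norm_num at this
  have hnull := hμ _ hne (Real.cos t * p₁ + Real.sin t * p₂)
  filter_upwards [compl_mem_ae_iff.2 hnull] with x hx
  have hx' : Real.cos t * (ℓ₁ x - p₁) + Real.sin t * (ℓ₂ x - p₂) ≠ 0 := by
    intro h
    refine hx ?_
    simp only [mem_ofPred_eq, add_apply, smul_apply,
      smul_eq_mul]
    linarith
  have hc : Continuous fun t => Real.cos t * (ℓ₁ x - p₁) + Real.sin t * (ℓ₂ x - p₂) := by fun_prop
  rcases lt_or_gt_of_ne hx' with h | h
  · refine (continuousAt_const (y := (0 : ℝ))).congr ?_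
    filter_upwards [hc.continuousAt.eventually (gt_mem_nhds h)] with t' ht'
    rw [indicator_of_notMem]
    rintro ⟨-, h'⟩
    exact ht'.not_ge h'
  · refine (continuousAt_const (y := S.indicator (1 : E → ℝ) x)).congr ?_
    filter_upwards [hc.continuousAt.eventually (lt_mem_nhds h)] with t' ht'
    rw [indicator_apply, indicator_apply]
    congr 1
    exact propext ⟨fun h => ⟨h, ht'.le⟩, fun h => h.1⟩

theorem measureReal_add_opposite_halfSpace (hμ : NullHyperplanes μ) (S : Set E)
    {ℓ : E →L[ℝ] ℝ} (hℓ : ℓ ≠ 0) (c : ℝ) :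
    μ.real (S ∩ {x | 0 ≤ ℓ x - c}) + μ.real (S ∩ {x | 0 ≤ -(ℓ x - c)}) = μ.real S := by
  have hm : MeasurableSet {x | 0 ≤ ℓ x - c} := measurableSet_le measurable_const (by fun_prop)
  rw [← measureReal_inter_add_sdiff (s := S) hm]
  congr 1
  refine measureReal_congr ?_
  filter_upwards [compl_mem_ae_iff.2 (hμ ℓ hℓ c)] with x hx
  have hx' : ℓ x ≠ c := hx
  refine propext ⟨fun h => ⟨h.1, fun h' => hx' ?_⟩, fun h => ⟨h.1, ?_⟩⟩
  · have h1 := h.2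
    simp only [mem_ofPred_eq] at h1 h'
    linarith
  · have h1 := h.2
    simp only [mem_ofPred_eq] at h1 ⊢
    linarith

theorem IsNeedle.exists_bisection (hC : IsNeedle μ A B θ θ' C) (hμ : NullHyperplanes μ)
    (hA : MeasurableSet A) {ℓ₁ ℓ₂ : E →L[ℝ] ℝ}
    (hℓ : ∀ a b : ℝ, a • ℓ₁ + b • ℓ₂ = 0 → a = 0 ∧ b = 0) (p₁ p₂ : ℝ) :
    ∃ a b : ℝ, (a ≠ 0 ∨ b ≠ 0) ∧
      IsNeedle μ A B θ θ' (C ∩ {x | 0 ≤ a * (ℓ₁ x - p₁) + b * (ℓ₂ x - p₂)}) := by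
  have hCm : MeasurableSet C := hC.isCompact.measurableSet
  set H : ℝ → Set E := fun t => {x | 0 ≤ Real.cos t * (ℓ₁ x - p₁) + Real.sin t * (ℓ₂ x - p₂)}
    with hH
  have hsum : ∀ S, ∀ t,
      μ.real (S ∩ H t) + μ.real (S ∩ H (t + Real.pi)) = μ.real S := by
    intro S t
    have hne : Real.cos t • ℓ₁ + Real.sin t • ℓ₂ ≠ 0 := fun h => by
      obtain ⟨h1, h2⟩ := hℓ _ _ h
      have := Real.sin_sq_add_cos_sq t
      rw [h1, h2] at this
      norm_num at this
    rw [← measureReal_add_opposite_halfSpace hμ S hne (Real.cos t * p₁ + Real.sin t * p₂)]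
    congr 3 <;> ext x <;> simp only [hH, mem_ofPred_eq, add_apply,
      smul_apply, smul_eq_mul, Real.cos_add_pi, Real.sin_add_pi] <;>
      constructor <;> intro h <;> linarith
  set F : ℝ → ℝ := fun t => μ.real (A ∩ C ∩ H t) - θ * μ.real (C ∩ H t) with hF
  have hFc : Continuous F :=
    (continuous_measureReal_rotating_halfSpace hμ (hA.inter hCm) hℓ p₁ p₂).sub
      ((continuous_measureReal_rotating_halfSpace hμ hCm hℓ p₁ p₂).const_mul θ)
  have hFπ : ∀ t, F t + F (t + Real.pi) = 0 := by
    intro t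
    have h1 := hsum (A ∩ C) t
    have h2 := hsum C t
    have h3 := hC.measure_inter_left
    simp only [hF]
    rw [← h1, ← h2] at h3
    linarith
  obtain ⟨t, ht⟩ : ∃ t, F t = 0 := by
    have h := hFπ 0
    rw [zero_add] at h
    rcases le_total (F 0) 0 with h0 | h0
    · exact mem_range_of_exists_le_of_exists_ge hFc ⟨0, h0⟩ ⟨Real.pi, by linarith⟩
    · exact mem_range_of_exists_le_of_exists_ge hFc ⟨Real.pi, by linarith⟩ ⟨0, h0⟩
  have key : ∀ t, F t = 0 → μ.real (B ∩ C ∩ H t) < θ' * μ.real (C ∩ H t) →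
      ∃ a b : ℝ, (a ≠ 0 ∨ b ≠ 0) ∧
      IsNeedle μ A B θ θ' (C ∩ {x | 0 ≤ a * (ℓ₁ x - p₁) + b * (ℓ₂ x - p₂)}) := by
    intro t ht htB
    refine ⟨Real.cos t, Real.sin t, ?_, ?_, ?_, ?_, ?_⟩
    · by_contra! h
      have := Real.sin_sq_add_cos_sq t
      rw [h.1, h.2] at this
      norm_num at this
    · exact hC.isCompact.inter_right (isClosed_le continuous_const (by fun_prop))
    · refine hC.convex.inter ?_
      have : Convex ℝ {x | Real.cos t * p₁ + Real.sin t * p₂ ≤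
          (Real.cos t • ℓ₁ + Real.sin t • ℓ₂) x} :=
        convex_halfSpace_ge (LinearMap.isLinear
          (Real.cos t • ℓ₁ + Real.sin t • ℓ₂ : E →L[ℝ] ℝ).toLinearMap) _
      convert this using 1
      ext x
      simp only [mem_ofPred_eq, add_apply,
        smul_apply, smul_eq_mul]
      constructor <;> intro h <;> linarith
    · rw [← inter_assoc]; exact sub_eq_zero.1 ht
    · rw [← inter_assoc]; exact htB
  by_cases h : μ.real (B ∩ C ∩ H t) < θ' * μ.real (C ∩ H t)
  · exact key t ht h
  · refine key (t + Real.pi) (by linarith [hFπ t]) ?_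
    have h1 := hsum (B ∩ C) t
    have h2 := hsum C t
    have h3 := hC.measure_inter_right
    rw [← h1, ← h2] at h3
    linarith

theorem planar_det_eq_zero {x₁ x₂ y₁ y₂ z₁ z₂ : ℝ}
    (h : ∀ p₁ p₂ : ℚ, ∃ a b : ℝ, (a ≠ 0 ∨ b ≠ 0) ∧ 0 ≤ a * (x₁ - p₁) + b * (x₂ - p₂) ∧
      0 ≤ a * (y₁ - p₁) + b * (y₂ - p₂) ∧ 0 ≤ a * (z₁ - p₁) + b * (z₂ - p₂)) :
    (y₁ - x₁) * (z₂ - x₂) - (y₂ - x₂) * (z₁ - x₁) = 0 := by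
  by_contra hD
  set D := (y₁ - x₁) * (z₂ - x₂) - (y₂ - x₂) * (z₁ - x₁) with hDdef
  set α : ℝ × ℝ → ℝ := fun p => ((p.1 - x₁) * (z₂ - x₂) - (p.2 - x₂) * (z₁ - x₁)) / D with hα
  set β : ℝ × ℝ → ℝ := fun p => ((y₁ - x₁) * (p.2 - x₂) - (y₂ - x₂) * (p.1 - x₁)) / D with hβ
  have hαc : Continuous α := by fun_prop
  have hβc : Continuous β := by fun_prop
  have hopen : IsOpen {p | 0 < α p ∧ 0 < β p ∧ α p + β p < 1} :=
    (isOpen_lt continuous_const hαc).inter ((isOpen_lt continuous_const hβc).inter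
      (isOpen_lt (hαc.add hβc) continuous_const))
  have hne : {p | 0 < α p ∧ 0 < β p ∧ α p + β p < 1}.Nonempty := by
    refine ⟨((x₁ + y₁ + z₁) / 3, (x₂ + y₂ + z₂) / 3), ?_⟩
    have h1 : α ((x₁ + y₁ + z₁) / 3, (x₂ + y₂ + z₂) / 3) = 1 / 3 := by
      simp only [hα]; rw [div_eq_iff hD, hDdef]; ring
    have h2 : β ((x₁ + y₁ + z₁) / 3, (x₂ + y₂ + z₂) / 3) = 1 / 3 := by
      simp only [hβ]; rw [div_eq_iff hD, hDdef]; ring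
    simp only [mem_ofPred_eq, h1, h2]
    norm_num
  obtain ⟨⟨p₁, p₂⟩, hp1, hp2, hp3⟩ := ((Rat.denseRange_cast (𝕜 := ℝ)).prodMap
    (Rat.denseRange_cast (𝕜 := ℝ))).exists_mem_open hopen hne
  simp only [Prod.map_apply] at hp1 hp2 hp3
  set s := α ((p₁ : ℝ), (p₂ : ℝ)) with hs
  set t := β ((p₁ : ℝ), (p₂ : ℝ)) with ht
  have e1 : (p₁ : ℝ) = (1 - s - t) * x₁ + s * y₁ + t * z₁ := by
    rw [hs, ht]; simp only [hα, hβ]; field_simp; rw [hDdef]; ring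
  have e2 : (p₂ : ℝ) = (1 - s - t) * x₂ + s * y₂ + t * z₂ := by
    rw [hs, ht]; simp only [hα, hβ]; field_simp; rw [hDdef]; ring
  obtain ⟨a, b, hab, hx, hy, hz⟩ := h p₁ p₂
  have hzero : (1 - s - t) * (a * (x₁ - p₁) + b * (x₂ - p₂)) +
      s * (a * (y₁ - p₁) + b * (y₂ - p₂)) + t * (a * (z₁ - p₁) + b * (z₂ - p₂)) = 0 := by
    linear_combination (-a) * e1 - b * e2
  have gx : a * (x₁ - p₁) + b * (x₂ - p₂) = 0 := by
    by_contra hn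
    have : 0 < a * (x₁ - p₁) + b * (x₂ - p₂) := lt_of_le_of_ne hx (Ne.symm hn)
    have : 0 < (1 - s - t) * (a * (x₁ - p₁) + b * (x₂ - p₂)) := mul_pos (by linarith) this
    linarith [mul_nonneg hp1.le hy, mul_nonneg hp2.le hz]
  have gy : a * (y₁ - p₁) + b * (y₂ - p₂) = 0 := by
    by_contra hn
    have : 0 < a * (y₁ - p₁) + b * (y₂ - p₂) := lt_of_le_of_ne hy (Ne.symm hn)
    rw [gx] at hzero
    linarith [mul_pos hp1 this, mul_nonneg hp2.le hz]
  have gz : a * (z₁ - p₁) + b * (z₂ - p₂) = 0 := by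
    rw [gx, gy] at hzero
    simpa [hp2.ne'] using hzero
  have ha : a * D = 0 := by
    rw [hDdef]
    linear_combination (z₂ - x₂) * (gy - gx) - (y₂ - x₂) * (gz - gx)
  have hb : b * D = 0 := by
    rw [hDdef]
    linear_combination (y₁ - x₁) * (gz - gx) - (z₁ - x₁) * (gy - gx)
  rcases hab with h | h
  · exact h ((mul_eq_zero.1 ha).resolve_right hD)
  · exact h ((mul_eq_zero.1 hb).resolve_right hD)

theorem exists_line_of_minors_eq_zero {ι : Type*} {D : Set (ι → ℝ)} (hD : D.Nonempty)
    (h : ∀ x ∈ D, ∀ y ∈ D, ∀ z ∈ D, ∀ i j,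
      (y i - x i) * (z j - x j) - (y j - x j) * (z i - x i) = 0) :
    ∃ x ∈ D, ∃ v, ((v = 0 → D ⊆ {x}) ∧ ∀ y ∈ D, ∃ t : ℝ, y = x + t • v) := by
  obtain ⟨x, hx⟩ := hD
  by_cases hs : D ⊆ {x}
  · exact ⟨x, hx, 0, fun _ => hs, fun y hy => ⟨0, by simpa using hs hy⟩⟩
  obtain ⟨y, hy, hyx⟩ := not_subset.1 hs
  obtain ⟨i, hi⟩ := Function.ne_iff.1 (mt mem_singleton_iff.2 hyx)
  have hi' : y i - x i ≠ 0 := sub_ne_zero.2 hi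
  refine ⟨x, hx, y - x, fun h0 => absurd (sub_eq_zero.1 h0) hyx, fun z hz => ?_⟩
  refine ⟨(z i - x i) / (y i - x i), ?_⟩
  ext j
  have := h x hx y hy z hz i j
  simp only [Pi.add_apply, Pi.smul_apply, Pi.sub_apply, smul_eq_mul]
  field_simp
  linarith

/-- A compact convex set can be cut down to an arbitrarily thin one, keeping the exact proportion
of `A` and an upper bound for the proportion of `B`. -/
theorem IsNeedle.exists_thin [FiniteDimensional ℝ E] [Nontrivial E] (hC : IsNeedle μ A B θ θ' C)
    (hμ : NullHyperplanes μ) (hA : MeasurableSet A)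
    {M : E → ℝ} (hM : Continuous M) (hM0 : M 0 = 0) {δ : ℝ} (hδ : 0 < δ) :
    ∃ C', IsNeedle μ A B θ θ' C' ∧ ∃ x v : E, v ≠ 0 ∧ ∀ y ∈ C', ∃ t : ℝ, M (y - x - t • v) < δ := by
  set b := Module.finBasis ℝ E with hb
  set m := Module.finrank ℝ E with hm
  have : Nonempty (Fin m) := ⟨⟨0, Module.finrank_pos⟩⟩
  set e : E ≃L[ℝ] (Fin m → ℝ) := b.equivFunL with he
  set ℓ : Fin m → E →L[ℝ] ℝ := fun i => (ContinuousLinearMap.proj i).comp (e : E →L[ℝ] (Fin m → ℝ))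
    with hℓ
  have hℓapp : ∀ i x, ℓ i x = e x i := fun i x => rfl
  have hind : ∀ i j, i ≠ j → ∀ a c : ℝ, a • ℓ i + c • ℓ j = 0 → a = 0 ∧ c = 0 := by
    intro i j hij a c h
    have h1 : ∀ x : Fin m → ℝ, a * x i + c * x j = 0 := fun x => by
      have := congrArg (fun f : E →L[ℝ] ℝ => f (e.symm x)) h
      simpa [hℓapp] using this
    have h2 := h1 (Pi.single i 1)
    have h3 := h1 (Pi.single j 1)
    simp [hij, hij.symm] at h2 h3
    exact ⟨h2, h3⟩
  set Q := Fin m × Fin m × ℚ × ℚ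
  have hstep : ∀ (q : Q) (D : {D : Set E // IsNeedle μ A B θ θ' D}),
      ∃ D' : {D : Set E // IsNeedle μ A B θ θ' D}, D'.1 ⊆ D.1 ∧ (q.1 ≠ q.2.1 →
        ∃ a c : ℝ, (a ≠ 0 ∨ c ≠ 0) ∧ ∀ x ∈ D'.1,
          0 ≤ a * (e x q.1 - q.2.2.1) + c * (e x q.2.1 - q.2.2.2)) := by
    rintro ⟨i, j, p₁, p₂⟩ ⟨D, hD⟩
    by_cases hij : i = j
    · exact ⟨⟨D, hD⟩, Subset.rfl, fun h => absurd hij h⟩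
    obtain ⟨a, c, hac, hD'⟩ := hD.exists_bisection hμ hA (hind i j hij) p₁ p₂
    exact ⟨⟨_, hD'⟩, inter_subset_left, fun _ => ⟨a, c, hac, fun x hx => hx.2⟩⟩
  choose f hfsub hf using hstep
  obtain ⟨enum, henum⟩ := exists_surjective_nat Q
  set Cs : ℕ → {D : Set E // IsNeedle μ A B θ θ' D} :=
    fun k => Nat.rec ⟨C, hC⟩ (fun k D => f (enum k) D) k with hCs
  have hsucc : ∀ k, Cs (k + 1) = f (enum k) (Cs k) := fun k => rfl
  have hanti : Antitone fun k => (Cs k).1 := antitone_nat_of_succ_le fun k => by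
    rw [hsucc]; exact hfsub _ _
  have hne : ∀ k, (Cs k).1.Nonempty := fun k => by
    by_contra h
    have := (Cs k).2.measure_inter_right
    rw [not_nonempty_iff_eq_empty.1 h] at this
    simp at this
  have hcpt : ∀ k, IsCompact (Cs k).1 := fun k => (Cs k).2.isCompact
  have hDne : (⋂ k, (Cs k).1).Nonempty :=
    IsCompact.nonempty_iInter_of_sequence_nonempty_isCompact_isClosed _
      (fun k => hanti (Nat.le_succ k)) hne (hcpt 0) fun k => (hcpt k).isClosed
  have hmin : ∀ x ∈ e '' (⋂ k, (Cs k).1), ∀ y ∈ e '' (⋂ k, (Cs k).1), ∀ z ∈ e '' (⋂ k, (Cs k).1),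
      ∀ i j, (y i - x i) * (z j - x j) - (y j - x j) * (z i - x i) = 0 := by
    rintro _ ⟨x, hx, rfl⟩ _ ⟨y, hy, rfl⟩ _ ⟨z, hz, rfl⟩ i j
    by_cases hij : i = j
    · rw [hij]; ring
    refine planar_det_eq_zero fun p₁ p₂ => ?_
    obtain ⟨k, hk⟩ := henum (i, j, p₁, p₂)
    have := hf (enum k) (Cs k)
    rw [← hsucc, hk] at this
    obtain ⟨a, c, hac, h⟩ := this hij
    exact ⟨a, c, hac, h x (mem_iInter.1 hx (k + 1)), h y (mem_iInter.1 hy (k + 1)),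
      h z (mem_iInter.1 hz (k + 1))⟩
  obtain ⟨_, ⟨x, hx, rfl⟩, v, hv0, hv⟩ := exists_line_of_minors_eq_zero (hDne.image e) hmin
  obtain ⟨w, hw, hxw⟩ : ∃ w : E, w ≠ 0 ∧ ∀ y ∈ ⋂ k, (Cs k).1, ∃ t : ℝ, y = x + t • w := by
    by_cases hvz : v = 0
    · obtain ⟨w, hw⟩ := exists_ne (0 : E)
      refine ⟨w, hw, fun y hy => ⟨0, ?_⟩⟩
      have := hv0 hvz (mem_image_of_mem e hy)
      simpa using this
    · refine ⟨e.symm v, by simpa using hvz, fun y hy => ?_⟩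
      obtain ⟨t, ht⟩ := hv _ (mem_image_of_mem e hy)
      refine ⟨t, e.injective ?_⟩
      simpa using ht
  have hU : IsOpen (⋃ t : ℝ, {y | M (y - x - t • w) < δ}) :=
    isOpen_iUnion fun t => isOpen_lt (by fun_prop) continuous_const
  obtain ⟨k, hk⟩ := exists_subset_nhds_of_isCompact hanti.directed_ge hcpt
    (U := ⋃ t : ℝ, {y | M (y - x - t • w) < δ}) fun y hy => hU.mem_nhds (by
      obtain ⟨t, ht⟩ := hxw y hy
      refine mem_iUnion.2 ⟨t, ?_⟩
      simp [ht, hM0, hδ])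
  refine ⟨_, (Cs k).2, x, w, hw, fun y hy => ?_⟩
  obtain ⟨t, ht⟩ := mem_iUnion.1 (hk hy)
  exact ⟨t, ht⟩

end Bisection

section Isoperimetry

open Filter Topology Set Metric
open scoped ENNReal

theorem Seminorm.exists_dual_apply_eq {E : Type*} [NormedAddCommGroup E] [NormedSpace ℝ E]
    (M : Seminorm ℝ E) (hM : Continuous M) {v : E} (hv : v ≠ 0) :
    ∃ α : E →L[ℝ] ℝ, α v = M v ∧ ∀ x, |α x| ≤ M x := by
  set e := LinearEquiv.toSpanNonzeroSingleton ℝ E v hv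
  have he : ∀ t, ((e t : ℝ ∙ v) : E) = t • v := fun t => rfl
  have hf : ∀ t, (M v • e.symm.toLinearMap) (e t) = M v * t := fun t => by
    rw [LinearMap.smul_apply, LinearEquiv.coe_coe, e.symm_apply_apply, smul_eq_mul]
  obtain ⟨α, hα, hle⟩ := Module.Dual.exists_continuous_extension_of_le_seminorm_real
    (ℝ ∙ v) (M v • e.symm.toLinearMap) hM (fun x => by
      obtain ⟨t, rfl⟩ := e.surjective x
      rw [hf, he, map_smul_eq_mul, Real.norm_eq_abs, mul_comm]
      exact mul_le_mul_of_nonneg_right (le_abs_self t) (apply_nonneg M v))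
  refine ⟨α, ?_, hle⟩
  have h := hα (e 1)
  rwa [hf, he, one_smul, mul_one] at h

theorem addHaar_preimage_eq_zero {E : Type*} [NormedAddCommGroup E] [NormedSpace ℝ E]
    [FiniteDimensional ℝ E] [MeasurableSpace E] [BorelSpace E] (m : Measure E)
    [m.IsAddHaarMeasure] {α : E →L[ℝ] ℝ} (hα : α ≠ 0) {s : Set ℝ} (hs : volume s = 0) :
    m (α ⁻¹' s) = 0 := by
  have hsurj : Function.Surjective (α : E →ₗ[ℝ] ℝ) :=
    LinearMap.surjective fun h => hα (ContinuousLinearMap.coe_injective h)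
  have := FiniteDimensional.proper_real E
  obtain ⟨c, -, hc⟩ := LinearMap.exists_map_addHaar_eq_smul_addHaar (α : E →ₗ[ℝ] ℝ) m
    (volume : Measure ℝ) hsurj
  have h1 : (volume : Measure ℝ) (toMeasurable volume s) = 0 := by rwa [measure_toMeasurable]
  refine measure_mono_null (preimage_mono (subset_toMeasurable volume s)) ?_
  have h2 := congrArg (fun μ => μ (toMeasurable volume s)) hc
  simp only [Measure.smul_apply, h1, smul_zero] at h2
  rwa [Measure.map_apply (by exact α.continuous.measurable) (measurableSet_toMeasurable _ _)] at h2

variable {E : Type*} [NormedAddCommGroup E] [NormedSpace ℝ E]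

/-- The function `Ψ` is `1`-convex relative to the seminorm `M`. -/
def IsUniformlyConvexWrt (M : Seminorm ℝ E) (Ψ : E → ℝ) : Prop :=
  ∀ x y : E, ∀ l : ℝ, 0 < l → l < 1 →
    Ψ ((1 - l) • x + l • y) ≤ (1 - l) * Ψ x + l * Ψ y - (1 - l) * l / 2 * M (y - x) ^ 2

theorem IsUniformlyConvexWrt.sub_sq {M : Seminorm ℝ E} {Ψ : E → ℝ}
    (hΨ : IsUniformlyConvexWrt M Ψ) {α : E →L[ℝ] ℝ} (hα : ∀ x, |α x| ≤ M x) (s : ℝ) (x y : E)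
    {l : ℝ} (h0 : 0 < l) (h1 : l < 1) :
    Ψ ((1 - l) • x + l • y) - (α ((1 - l) • x + l • y) - s) ^ 2 / 2 ≤
      (1 - l) * (Ψ x - (α x - s) ^ 2 / 2) + l * (Ψ y - (α y - s) ^ 2 / 2) := by
  have h2 := hΨ x y l h0 h1
  have h3 : (α y - α x) ^ 2 ≤ M (y - x) ^ 2 := by
    rw [← map_sub, ← sq_abs]
    exact pow_le_pow_left₀ (abs_nonneg _) (hα _) 2
  have h4 : 0 ≤ (1 - l) * l / 2 := by
    have := sub_pos.2 h1; positivity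
  rw [map_add, map_smul, map_smul, smul_eq_mul, smul_eq_mul]
  nlinarith [mul_le_mul_of_nonneg_left h3 h4]

variable [MeasurableSpace E] [BorelSpace E]

theorem min_lintegral_slab_le {m : Measure E} (hm : IsPrekopaLeindler m) {V : E → ℝ}
    (hVc : Continuous V)
    (hV : ∀ x y : E, ∀ l : ℝ, 0 < l → l < 1 →
      V ((1 - l) • x + l • y) ≤ (1 - l) * V x + l * V y)
    {C : Set E} (hCm : MeasurableSet C) (hC : Convex ℝ C) (α : E →L[ℝ] ℝ) {z₁ z₂ z₃ h : ℝ}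
    (h12 : z₁ ≤ z₂) (h23 : z₂ ≤ z₃) :
    min (∫⁻ x in C ∩ α ⁻¹' closedBall z₁ h, ENNReal.ofReal (Real.exp (-V x)) ∂m)
      (∫⁻ x in C ∩ α ⁻¹' closedBall z₃ h, ENNReal.ofReal (Real.exp (-V x)) ∂m) ≤
      ∫⁻ x in C ∩ α ⁻¹' closedBall z₂ h, ENNReal.ofReal (Real.exp (-V x)) ∂m := by
  rcases eq_or_lt_of_le h12 with rfl | h12
  · exact min_le_left _ _
  rcases eq_or_lt_of_le h23 with rfl | h23
  · exact min_le_right _ _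
  have hS : ∀ z, MeasurableSet (C ∩ α ⁻¹' closedBall z h) := fun z =>
    hCm.inter (α.continuous.measurable measurableSet_closedBall)
  set w : E → ℝ≥0∞ := fun x => ENNReal.ofReal (Real.exp (-V x)) with hw
  have hwm : Measurable w := by fun_prop
  set l := (z₂ - z₁) / (z₃ - z₁) with hl
  have hd : 0 < z₃ - z₁ := by linarith
  have hl0 : 0 < l := div_pos (by linarith) hd
  have hl1 : l < 1 := (div_lt_one hd).2 (by linarith)
  have hl1' : 0 < 1 - l := sub_pos.2 hl1
  have hz : z₂ = (1 - l) * z₁ + l * z₃ := by rw [hl]; field_simp; ring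
  have key := hm _ _ _ (hwm.indicator (hS z₁)) (hwm.indicator (hS z₃)) (hwm.indicator (hS z₂))
    l hl0 hl1 (by
      intro x y
      by_cases hx : x ∈ C ∩ α ⁻¹' closedBall z₁ h
      swap
      · rw [indicator_of_notMem hx, ENNReal.zero_rpow_of_pos hl1', zero_mul]; exact zero_le
      by_cases hy : y ∈ C ∩ α ⁻¹' closedBall z₃ h
      swap
      · rw [indicator_of_notMem hy, ENNReal.zero_rpow_of_pos hl0, mul_zero]; exact zero_le
      have hxy : (1 - l) • x + l • y ∈ C ∩ α ⁻¹' closedBall z₂ h := by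
        refine ⟨hC hx.1 hy.1 hl1'.le hl0.le (by ring), ?_⟩
        have h1 := mem_closedBall.1 hx.2
        have h2 := mem_closedBall.1 hy.2
        rw [mem_preimage, mem_closedBall, map_add, map_smul, map_smul, smul_eq_mul, smul_eq_mul, hz]
        rw [Real.dist_eq] at *
        rw [abs_le] at *
        constructor <;> nlinarith
      rw [indicator_of_mem hx, indicator_of_mem hy, indicator_of_mem hxy, hw]
      simp only
      rw [ENNReal.ofReal_rpow_of_pos (Real.exp_pos _), ENNReal.ofReal_rpow_of_pos (Real.exp_pos _),
        ← ENNReal.ofReal_mul (by positivity), ← Real.exp_mul, ← Real.exp_mul, ← Real.exp_add]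
      refine ENNReal.ofReal_le_ofReal (Real.exp_le_exp.2 ?_)
      linarith [hV x y l hl0 hl1])
  rw [lintegral_indicator (hS _), lintegral_indicator (hS _), lintegral_indicator (hS _)] at key
  refine le_trans ?_ key
  set F := ∫⁻ x in C ∩ α ⁻¹' closedBall z₁ h, w x ∂m
  set G := ∫⁻ x in C ∩ α ⁻¹' closedBall z₃ h, w x ∂m
  calc min F G = min F G ^ (1 - l) * min F G ^ l := by
        rw [← ENNReal.rpow_add_of_nonneg _ _ hl1'.le hl0.le, sub_add_cancel, ENNReal.rpow_one]
    _ ≤ F ^ (1 - l) * G ^ l := by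
        gcongr
        · exact min_le_left _ _
        · exact min_le_right _ _

/-- The image under `α` of the normalized restriction of `μ` to `C`. -/
noncomputable def needleMarginal (μ : Measure E) (C : Set E) (α : E →L[ℝ] ℝ) : Measure ℝ :=
  (μ C)⁻¹ • (μ.restrict C).map α

theorem needleMarginal_apply (μ : Measure E) (C : Set E) (α : E →L[ℝ] ℝ) {s : Set ℝ}
    (hs : MeasurableSet s) : needleMarginal μ C α s = (μ C)⁻¹ * μ (α ⁻¹' s ∩ C) := by
  rw [needleMarginal, Measure.smul_apply, Measure.map_apply α.continuous.measurable hs,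
    Measure.restrict_apply (α.continuous.measurable hs), smul_eq_mul]

theorem isBallQuasiconcave_gaussTilt_needleMarginal {m : Measure E} [SFinite m]
    (hm : IsPrekopaLeindler m)
    {M : Seminorm ℝ E} {Ψ : E → ℝ} (hΨc : Continuous Ψ) (hΨ : IsUniformlyConvexWrt M Ψ)
    {C : Set E} (hCm : MeasurableSet C) (hC : Convex ℝ C) {α : E →L[ℝ] ℝ}
    (hα : ∀ x, |α x| ≤ M x) (s : ℝ) :
    IsBallQuasiconcave (gaussTilt (needleMarginal
      (m.withDensity fun x => ENNReal.ofReal (Real.exp (-Ψ x))) C α) s) := by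
  set μ := m.withDensity fun x => ENNReal.ofReal (Real.exp (-Ψ x)) with hμ
  have happ : ∀ z h, gaussTilt (needleMarginal μ C α) s (closedBall z h) = (μ C)⁻¹ *
      ∫⁻ x in C ∩ α ⁻¹' closedBall z h,
        ENNReal.ofReal (Real.exp (-(Ψ x - (α x - s) ^ 2 / 2))) ∂m := by
    intro z h
    have hαm := α.continuous.measurable
    have hms : MeasurableSet (α ⁻¹' closedBall z h) := hαm measurableSet_closedBall
    rw [gaussTilt, withDensity_apply _ measurableSet_closedBall, needleMarginal,
      Measure.restrict_smul, lintegral_smul_measure, smul_eq_mul,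
      setLIntegral_map measurableSet_closedBall (by fun_prop) hαm, Measure.restrict_restrict hms,
      inter_comm, hμ, restrict_withDensity (hCm.inter hms),
      lintegral_withDensity_eq_lintegral_mul _ (by fun_prop) (by fun_prop)]
    congr 2
    ext x
    rw [Pi.mul_apply, ← ENNReal.ofReal_mul (Real.exp_pos _).le, ← Real.exp_add]
    congr 2
    ring
  intro x y z h hxy hyz _
  rw [happ, happ, happ, min_le_iff]
  refine (min_le_iff.1 ?_).imp (fun h => mul_le_mul_right h _) fun h => mul_le_mul_right h _
  exact min_lintegral_slab_le hm (V := fun x => Ψ x - (α x - s) ^ 2 / 2) (by fun_prop)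
    (fun x y l h0 h1 => hΨ.sub_sq hα s x y h0 h1) hCm hC α hxy hyz

theorem IsNeedle.false_of_thin [FiniteDimensional ℝ E] {m : Measure E} [m.IsAddHaarMeasure]
    (hm : IsPrekopaLeindler m) {M : Seminorm ℝ E} (hM : Continuous M) {Ψ : E → ℝ}
    (hΨc : Continuous Ψ) (hΨ : IsUniformlyConvexWrt M Ψ) {μ : Measure E} [IsFiniteMeasure μ]
    (hμ : μ = m.withDensity fun x => ENNReal.ofReal (Real.exp (-Ψ x)))
    {A B C : Set E} {c r r' δ : ℝ} (hr' : 0 < r') (hδ : r' + 4 * δ ≤ r) (hA : IsClosed A)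
    (hAB : ∀ y ∈ A, ∀ x, M (x - y) < r → x ∈ B)
    (hC : IsNeedle μ A B (gaussCDF c) (gaussCDF (c + r')) C)
    {p v : E} (hv : 0 < M v) (hthin : ∀ y ∈ C, ∃ t : ℝ, M (y - p - t • v) < δ) : False := by
  obtain ⟨α, hαv, hα⟩ := M.exists_dual_apply_eq hM (v := v) (by
    rintro rfl; simp at hv)
  have hα0 : α ≠ 0 := by
    rintro rfl
    simp [← hαv] at hv
  have hCm : MeasurableSet C := hC.isCompact.measurableSet
  have hμC : 0 < μ.real C := by
    by_contra! h
    have h1 := hC.measure_inter_right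
    have h2 : μ.real C = 0 := le_antisymm h measureReal_nonneg
    rw [h2, mul_zero] at h1
    exact h1.not_ge measureReal_nonneg
  have hμC' : μ C ≠ 0 := fun h => by simp [measureReal_def, h] at hμC
  set ν := needleMarginal μ C α with hν
  have hνapp : ∀ s, MeasurableSet s → ν.real s = (μ.real C)⁻¹ * μ.real (α ⁻¹' s ∩ C) := by
    intro s hs
    rw [measureReal_def, needleMarginal_apply _ _ _ hs, ENNReal.toReal_mul, ENNReal.toReal_inv]
    rfl
  have hνp : IsProbabilityMeasure ν := ⟨by
    rw [needleMarginal_apply _ _ _ MeasurableSet.univ, preimage_univ, univ_inter,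
      ENNReal.inv_mul_cancel hμC' (by finiteness)]⟩
  have hνv : ν ≪ volume := by
    refine Measure.AbsolutelyContinuous.mk fun s hs h0 => ?_
    rw [needleMarginal_apply _ _ _ hs]
    have : μ (α ⁻¹' s) = 0 := by
      rw [hμ]
      exact withDensity_absolutelyContinuous _ _ (addHaar_preimage_eq_zero m hα0 h0)
    rw [measure_mono_null inter_subset_left this, mul_zero]
  have : NullSingletonClass ν := ⟨fun x => hνv (measure_singleton x)⟩
  have hhl : HalfLineComparison ν := fun a b r hr hab =>
    gaussCDF_add_le_of_isBallQuasiconcave hνv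
      (fun s => by
        rw [hν, hμ]
        exact isBallQuasiconcave_gaussTilt_needleMarginal hm hΨc hΨ hCm hC.convex hα s) hab hr
  have hdist : ∀ x ∈ C, ∀ y ∈ C, M (x - y) ≤ |α x - α y| + 4 * δ := by
    intro x hx y hy
    obtain ⟨t, ht⟩ := hthin x hx
    obtain ⟨t', ht'⟩ := hthin y hy
    set e := x - p - t • v with he
    set e' := y - p - t' • v with he'
    have hxy : x - y = (t - t') • v + (e - e') := by rw [he, he', sub_smul]; abel
    have h1 : M (e - e') ≤ 2 * δ := by linarith [map_sub_le_add M e e']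
    have h2 : M (x - y) ≤ |t - t'| * M v + 2 * δ := by
      have := map_add_le_add M ((t - t') • v) (e - e')
      rw [map_smul_eq_mul, Real.norm_eq_abs] at this
      rw [hxy]
      linarith
    have h3 : α x - α y = (t - t') * M v + α (e - e') := by
      rw [← map_sub, hxy, map_add, map_smul, hαv, smul_eq_mul]
    have h4 : |t - t'| * M v ≤ |α x - α y| + 2 * δ := by
      have h5 : |t - t'| * M v = |(t - t') * M v| := by rw [abs_mul, abs_of_pos hv]
      rw [h5, show (t - t') * M v = (α x - α y) - α (e - e') by rw [h3]; ring]
      exact (abs_sub _ _).trans (by linarith [hα (e - e')])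
    linarith
  set A' := α '' (A ∩ C) with hA'
  have hA'c : IsCompact A' := (hC.isCompact.inter_left hA).image α.continuous
  have h1 : gaussCDF c ≤ ν.real A' := by
    rw [hνapp _ hA'c.measurableSet, ← div_eq_inv_mul, le_div_iff₀ hμC, ← hC.measure_inter_left]
    exact measureReal_mono fun x hx => ⟨mem_image_of_mem α hx, hx.2⟩
  have h2 : ν.real (thickening r' A') < gaussCDF (c + r') := by
    rw [hνapp _ isOpen_thickening.measurableSet, ← div_eq_inv_mul, div_lt_iff₀ hμC]
    refine lt_of_le_of_lt (measureReal_mono ?_) hC.measure_inter_right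
    rintro x ⟨hx, hxC⟩
    refine ⟨?_, hxC⟩
    obtain ⟨_, ⟨y, hy, rfl⟩, hxy⟩ := mem_thickening_iff.1 hx
    rw [Real.dist_eq] at hxy
    exact hAB y hy.1 x (by linarith [hdist x hxC y hy.2])
  rcases lt_or_ge (ν.real A') 1 with h | h
  · obtain ⟨c', hc'⟩ := exists_gaussCDF_eq ((gaussCDF_pos c).trans_le h1) h
    have h3 := hhl.le_thickening hA'c.isClosed hr' hc'.symm
    rw [← hc', strictMono_gaussCDF.le_iff_le] at h1
    have := strictMono_gaussCDF.monotone (add_le_add_left h1 r')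
    linarith
  · have h3 : ν.real A' ≤ ν.real (thickening r' A') := measureReal_mono (self_subset_thickening hr' _)
    linarith [gaussCDF_lt_one (c + r')]

theorem nullHyperplanes_of_absolutelyContinuous [FiniteDimensional ℝ E] {m μ : Measure E}
    [m.IsAddHaarMeasure] (h : μ ≪ m) : NullHyperplanes μ := fun _ hℓ c =>
  h (addHaar_preimage_eq_zero m hℓ (s := {c}) (measure_singleton c))

/-- **Gaussian isoperimetric comparison** for measures with uniformly log-concave density. -/
theorem gaussCDF_add_le_measureReal_of_enlargement [FiniteDimensional ℝ E] [Nontrivial E]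
    {m : Measure E} [m.IsAddHaarMeasure]
    (hm : IsPrekopaLeindler m) {M : Seminorm ℝ E} (hM : Continuous M) (hMpos : ∀ v ≠ 0, 0 < M v)
    {Ψ : E → ℝ} (hΨc : Continuous Ψ) (hΨ : IsUniformlyConvexWrt M Ψ) {μ : Measure E}
    [IsProbabilityMeasure μ] (hμ : μ = m.withDensity fun x => ENNReal.ofReal (Real.exp (-Ψ x)))
    {A B : Set E} {c r : ℝ} (hr : 0 < r) (hA : IsClosed A)
    (hAB : ∀ y ∈ A, ∀ x, M (x - y) < r → x ∈ B) (hc : μ.real A = gaussCDF c) :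
    gaussCDF (c + r) ≤ μ.real B := by
  by_contra! hlt
  obtain ⟨r', hr'0, hr'r, hr'⟩ : ∃ r', 0 < r' ∧ r' < r ∧ μ.real B < gaussCDF (c + r') := by
    have hcont : Continuous fun r' => gaussCDF (c + r') := by
      have := continuous_gaussCDF; fun_prop
    have h1 := (hcont.tendsto r).eventually (lt_mem_nhds hlt)
    have h2 := (h1.filter_mono nhdsWithin_le_nhds).and (Ioo_mem_nhdsLT hr)
    obtain ⟨r', h3, h4⟩ := h2.exists
    exact ⟨r', h4.1, h4.2, h3⟩
  obtain ⟨c', hc'c, hc'⟩ : ∃ c', c' < c ∧ μ.real B < gaussCDF (c' + r') := by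
    have hcont : Continuous fun c' => gaussCDF (c' + r') := by
      have := continuous_gaussCDF; fun_prop
    have h1 := (hcont.tendsto c).eventually (lt_mem_nhds hr')
    obtain ⟨c', h3, h4⟩ := ((h1.filter_mono nhdsWithin_le_nhds).and
      (self_mem_nhdsWithin : Iio c ∈ 𝓝[<] c)).exists
    exact ⟨c', h4, h3⟩
  have hlim : ∀ S : Set E, Tendsto (fun k : ℕ => μ.real (S ∩ closedBall 0 k)) atTop
      (𝓝 (μ.real S)) := by
    intro S
    have hU : ⋃ k : ℕ, S ∩ closedBall (0 : E) k = S := by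
      rw [← inter_iUnion, iUnion_closedBall_nat, inter_univ]
    have := tendsto_measure_iUnion_atTop (μ := μ) (s := fun k : ℕ => S ∩ closedBall (0 : E) k)
      (fun i j hij => inter_subset_inter_right _
        (closedBall_subset_closedBall (by exact_mod_cast hij)))
    rw [hU] at this
    exact (ENNReal.tendsto_toReal (by finiteness)).comp this
  have hlim1 : Tendsto (fun k : ℕ => μ.real (closedBall (0 : E) k)) atTop (𝓝 1) := by
    have := hlim univ
    simpa using this
  have hlimA := (hlim A).div hlim1 one_ne_zero
  have hlimB := (hlim B).div hlim1 one_ne_zero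
  rw [div_one] at hlimA hlimB
  rw [hc] at hlimA
  obtain ⟨k, ⟨hk1, hk2⟩, hk3, hk4⟩ := (((hlimA.eventually (lt_mem_nhds
    (strictMono_gaussCDF hc'c))).and (hlimA.eventually (gt_mem_nhds (gaussCDF_lt_one c)))).and
    ((hlimB.eventually (gt_mem_nhds hc')).and
      (hlim1.eventually (lt_mem_nhds zero_lt_one)))).exists
  simp only [Pi.div_apply] at hk1 hk2 hk3
  obtain ⟨d, hd⟩ := exists_gaussCDF_eq ((gaussCDF_pos c').trans hk1) hk2
  rw [← hd, strictMono_gaussCDF.lt_iff_lt] at hk1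
  have := FiniteDimensional.proper_real E
  have hneedle : IsNeedle μ A B (gaussCDF d) (gaussCDF (d + r')) (closedBall 0 k) :=
    { isCompact := isCompact_closedBall _ _
      convex := convex_closedBall _ _
      measure_inter_left := by rw [hd, div_mul_cancel₀ _ hk4.ne']
      measure_inter_right := by
        rw [← div_lt_iff₀ hk4]
        exact hk3.trans (strictMono_gaussCDF (by linarith)) }
  obtain ⟨C, hC, p, v, hv, hthin⟩ := hneedle.exists_thin
    (nullHyperplanes_of_absolutelyContinuous (m := m)
      (by rw [hμ]; exact withDensity_absolutelyContinuous _ _)) hA.measurableSet hM (map_zero M)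
    (δ := (r - r') / 4) (by linarith)
  exact hC.false_of_thin hm hM hΨc hΨ hμ hr'0 (by linarith) hA hAB (hMpos v hv) hthin

end Isoperimetry

section AsymmetricNorm

open Filter Topology Set Metric

/-- A continuous, positive, positively homogeneous and subadditive function on `ℝⁿ`. -/
structure IsAsymmetricNorm {n : ℕ} (Nm : (Fin n → ℝ) → ℝ) : Prop where
  continuous : Continuous Nm
  pos : ∀ x, x ≠ 0 → 0 < Nm x
  smul : ∀ c : ℝ, 0 < c → ∀ x, Nm (c • x) = c * Nm x
  add_le : ∀ x y, Nm (x + y) ≤ Nm x + Nm y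

namespace IsAsymmetricNorm

variable {n : ℕ} {Nm : (Fin n → ℝ) → ℝ} (hN : IsAsymmetricNorm Nm)
include hN

theorem map_zero : Nm 0 = 0 := by
  have := hN.smul 2 two_pos 0
  rw [smul_zero] at this
  linarith

theorem exists_norm_le_mul : ∃ C, 0 < C ∧ ∀ x, ‖x‖ ≤ C * Nm x := by
  obtain ⟨a, ha, h⟩ := (isCompact_sphere (0 : Fin n → ℝ) 1).exists_forall_le'
    hN.continuous.continuousOn (a := 0) fun x hx => hN.pos x (by
      rintro rfl; simp at hx)
  refine ⟨a⁻¹, by positivity, fun x => ?_⟩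
  rcases eq_or_ne x 0 with rfl | hx
  · simp [hN.map_zero]
  · have hx' : 0 < ‖x‖ := norm_pos_iff.2 hx
    have h1 := h (‖x‖⁻¹ • x) (by simp [norm_smul, hx'.ne'])
    rw [hN.smul _ (by positivity), inv_mul_eq_div, le_div_iff₀ hx'] at h1
    rwa [inv_mul_eq_div, le_div_iff₀ ha, mul_comm]

theorem bddAbove_dualNorm (α : (Fin n → ℝ) →L[ℝ] ℝ) :
    BddAbove {r : ℝ | ∃ x : Fin n → ℝ, Nm x ≤ 1 ∧ r = α x} := by
  obtain ⟨C, hC, h⟩ := hN.exists_norm_le_mul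
  refine ⟨‖α‖ * C, ?_⟩
  rintro _ ⟨x, hx, rfl⟩
  calc α x ≤ ‖α x‖ := le_abs_self _
    _ ≤ ‖α‖ * ‖x‖ := α.le_opNorm x
    _ ≤ ‖α‖ * C := by
      gcongr
      exact (h x).trans (by nlinarith)

theorem dualNorm_nonneg (α : (Fin n → ℝ) →L[ℝ] ℝ) : 0 ≤ dualNorm Nm α :=
  le_csSup (hN.bddAbove_dualNorm α) ⟨0, by rw [hN.map_zero]; exact zero_le_one, by simp⟩

theorem dualNorm_le {α : (Fin n → ℝ) →L[ℝ] ℝ} {c : ℝ} (h : ∀ x, Nm x ≤ 1 → α x ≤ c) :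
    dualNorm Nm α ≤ c := by
  refine csSup_le ⟨0, 0, by rw [hN.map_zero]; exact zero_le_one, by simp⟩ ?_
  rintro _ ⟨x, hx, rfl⟩
  exact h x hx

theorem apply_le_dualNorm_mul (α : (Fin n → ℝ) →L[ℝ] ℝ) (x : Fin n → ℝ) :
    α x ≤ dualNorm Nm α * Nm x := by
  rcases eq_or_ne x 0 with rfl | hx
  · simp [hN.map_zero]
  · have hx' := hN.pos x hx
    have h : (Nm x)⁻¹ * α x ≤ dualNorm Nm α :=
      le_csSup (hN.bddAbove_dualNorm α) ⟨(Nm x)⁻¹ • x, by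
        rw [hN.smul _ (by positivity), inv_mul_cancel₀ hx'.ne'], by simp⟩
    rwa [inv_mul_eq_div, div_le_iff₀ hx'] at h

theorem dualNorm_smul {c : ℝ} (hc : 0 < c) (α : (Fin n → ℝ) →L[ℝ] ℝ) :
    dualNorm Nm (c • α) = c * dualNorm Nm α := by
  have key : ∀ {c : ℝ}, 0 < c → ∀ α : (Fin n → ℝ) →L[ℝ] ℝ,
      dualNorm Nm (c • α) ≤ c * dualNorm Nm α := by
    intro c hc α
    refine hN.dualNorm_le fun x hx => ?_
    have := hN.apply_le_dualNorm_mul α x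
    have h0 := hN.dualNorm_nonneg α
    simp only [FunLike.coe_smul, Pi.smul_apply, smul_eq_mul]
    gcongr
    nlinarith
  refine (key hc α).antisymm ?_
  have := key (inv_pos.2 hc) (c • α)
  rw [smul_smul, inv_mul_cancel₀ hc.ne', one_smul, inv_mul_eq_div, le_div_iff₀ hc] at this
  linarith

theorem continuous_dualNorm : Continuous (dualNorm Nm) := by
  obtain ⟨C, hC, h⟩ := hN.exists_norm_le_mul
  have key : ∀ α β : (Fin n → ℝ) →L[ℝ] ℝ, dualNorm Nm α ≤ dualNorm Nm β + C * dist α β := by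
    intro α β
    refine hN.dualNorm_le fun x hx => ?_
    have h1 := hN.apply_le_dualNorm_mul β x
    have h2 : (α - β) x ≤ ‖α - β‖ * ‖x‖ := (le_abs_self _).trans ((α - β).le_opNorm x)
    have h3 : ‖x‖ ≤ C := (h x).trans (by nlinarith)
    have h0 := hN.dualNorm_nonneg β
    have h4 : ‖α - β‖ * ‖x‖ ≤ ‖α - β‖ * C := by gcongr
    rw [dist_eq_norm]
    have h5 : (α - β) x = α x - β x := rfl
    nlinarith
  exact (LipschitzWith.of_le_add_mul (Real.toNNReal C) fun α β => by
    rw [Real.coe_toNNReal _ hC.le]; exact key α β).continuous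

theorem exists_seminorm : ∃ M : Seminorm ℝ (Fin n → ℝ), ∀ x, M x = max (Nm x) (Nm (-x)) := by
  have hneg : ∀ c : ℝ, ∀ x, 0 ≤ c → Nm (c • x) = c * Nm x := by
    intro c x hc
    rcases hc.eq_or_lt with rfl | hc
    · simp [hN.map_zero]
    · exact hN.smul c hc x
  refine ⟨Seminorm.of (fun x => max (Nm x) (Nm (-x))) (fun x y => ?_) (fun c x => ?_),
    fun x => rfl⟩
  · refine max_le ((hN.add_le x y).trans (add_le_add (le_max_left _ _) (le_max_left _ _))) ?_
    rw [neg_add]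
    exact (hN.add_le _ _).trans (add_le_add (le_max_right _ _) (le_max_right _ _))
  · rw [Real.norm_eq_abs]
    rcases le_total 0 c with hc | hc
    · rw [abs_of_nonneg hc, ← smul_neg, hneg c _ hc, hneg c _ hc, mul_max_of_nonneg _ _ hc]
    · rw [abs_of_nonpos hc, ← neg_smul, mul_max_of_nonneg _ _ (neg_nonneg.2 hc),
        ← hneg _ _ (neg_nonneg.2 hc), ← hneg _ _ (neg_nonneg.2 hc), smul_neg, neg_smul, neg_neg,
        max_comm]

end IsAsymmetricNorm

end AsymmetricNorm

section GaussianProduct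

open Filter Topology Set Metric ProbabilityTheory
open scoped ENNReal

theorem Seminorm.exists_prod_sqrt {E : Type*} [AddCommGroup E] [Module ℝ E] (M : Seminorm ℝ E) :
    ∃ M' : Seminorm ℝ (E × ℝ), ∀ z, M' z = √(M z.1 ^ 2 + z.2 ^ 2) := by
  refine ⟨Seminorm.of (fun z => √(M z.1 ^ 2 + z.2 ^ 2)) (fun z w => ?_) (fun c z => ?_),
    fun z => rfl⟩
  · have h1 := map_add_le_add M z.1 w.1
    have h2 := norm_add_le (⟨M z.1, z.2⟩ : ℂ) ⟨M w.1, w.2⟩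
    simp only [Complex.norm_eq_sqrt_sq_add_sq, Complex.add_re, Complex.add_im] at h2
    refine le_trans (Real.sqrt_le_sqrt ?_) h2
    have h3 := apply_nonneg M (z.1 + w.1)
    simp only [Prod.fst_add, Prod.snd_add]
    gcongr
  · simp only [Prod.smul_fst, Prod.smul_snd, map_smul_eq_mul, smul_eq_mul, Real.norm_eq_abs]
    rw [mul_pow, mul_pow, sq_abs, ← mul_add, Real.sqrt_mul (sq_nonneg c), Real.sqrt_sq_eq_abs]

theorem measureReal_prod_gaussianReal_subgraph {E : Type*} [TopologicalSpace E] [MeasurableSpace E]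
    [OpensMeasurableSpace E] (μ : Measure E) [IsProbabilityMeasure μ]
    {h : E → ℝ} (hh : Continuous h) :
    (μ.prod (gaussianReal 0 1)).real {z | z.2 ≤ h z.1} = ∫ x, gaussCDF (h x) ∂μ := by
  have hm : MeasurableSet {z : E × ℝ | z.2 ≤ h z.1} :=
    measurableSet_le measurable_snd (hh.measurable.comp measurable_fst)
  rw [measureReal_def, Measure.prod_apply hm, ← integral_toReal]
  · refine integral_congr_ae (Eventually.of_forall fun x => ?_)
    exact gaussianReal_real_Iic_zero (h x)
  · exact (measurable_measure_prodMk_left hm).aemeasurable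
  · exact Eventually.of_forall fun x => measure_lt_top _ _

theorem gaussCDF_add_le_integral {n : ℕ} {M : Seminorm ℝ (Fin n → ℝ)} (hM : Continuous M)
    (hMpos : ∀ v ≠ 0, 0 < M v) {Φ : (Fin n → ℝ) → ℝ} (hΦc : Continuous Φ)
    (hΦ : IsUniformlyConvexWrt M Φ) {μ : Measure (Fin n → ℝ)} [IsProbabilityMeasure μ]
    (hμ : μ = volume.withDensity fun x => ENNReal.ofReal (Real.exp (-Φ x)))
    {h g : (Fin n → ℝ) → ℝ} (hh : Continuous h) (hg : Continuous g) {c r : ℝ} (hr : 0 < r)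
    (hhg : ∀ x y t, M (x - y) ^ 2 + t ^ 2 < r ^ 2 → h y + t ≤ g x)
    (hc : ∫ x, gaussCDF (h x) ∂μ = gaussCDF c) :
    gaussCDF (c + r) ≤ ∫ x, gaussCDF (g x) ∂μ := by
  obtain ⟨M', hM'⟩ := M.exists_prod_sqrt
  have hM'c : Continuous M' := by
    have : (M' : (Fin n → ℝ) × ℝ → ℝ) = fun z => √(M z.1 ^ 2 + z.2 ^ 2) := funext hM'
    rw [this]
    fun_prop
  have hM'pos : ∀ v ≠ 0, 0 < M' v := by
    rintro ⟨x, t⟩ hv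
    rw [hM', Real.sqrt_pos]
    rcases eq_or_ne x 0 with rfl | hx
    · have ht : t ≠ 0 := by rintro rfl; exact hv rfl
      simp only [map_zero]
      positivity
    · have := hMpos x hx
      simp only
      positivity
  set Ψ : (Fin n → ℝ) × ℝ → ℝ := fun z => Φ z.1 + z.2 ^ 2 / 2 + Real.log √(2 * Real.pi) with hΨdef
  have hΨc : Continuous Ψ := by fun_prop
  have hΨ : IsUniformlyConvexWrt M' Ψ := by
    intro z w l h0 h1
    have := hΦ z.1 w.1 l h0 h1
    rw [hM', Real.sq_sqrt (by positivity)]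
    simp only [hΨdef, Prod.fst_add, Prod.snd_add, Prod.smul_fst, Prod.smul_snd, Prod.fst_sub,
      Prod.snd_sub, smul_eq_mul]
    nlinarith
  have hexp : ∀ z, Real.exp (-Ψ z) = Real.exp (-Φ z.1) * gaussPDF z.2 := by
    intro z
    have hpos : 0 < √(2 * Real.pi) := Real.sqrt_pos.2 (by positivity)
    rw [hΨdef, gaussPDF]
    simp only [neg_add]
    rw [Real.exp_add, Real.exp_add, Real.exp_neg (Real.log _), Real.exp_log hpos, neg_div]
    ring
  have hμ' : μ.prod (gaussianReal 0 1) =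
      ((volume : Measure (Fin n → ℝ)).prod (volume : Measure ℝ)).withDensity fun z =>
        ENNReal.ofReal (Real.exp (-Ψ z)) := by
    rw [gaussianReal_of_var_ne_zero _ one_ne_zero, hμ, prod_withDensity (by fun_prop)
      (measurable_gaussianPDF 0 1)]
    congr 1
    ext z
    rw [hexp, ENNReal.ofReal_mul (Real.exp_pos _).le, gaussPDF_eq, gaussianPDF]
  have := gaussCDF_add_le_measureReal_of_enlargement
    ((isPrekopaLeindler_pi n).prod isPrekopaLeindler_real) hM'c hM'pos hΨc hΨ hμ'
    (A := {z | z.2 ≤ h z.1}) (B := {z | z.2 ≤ g z.1}) (c := c) hr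
    (isClosed_le continuous_snd (hh.comp continuous_fst))
    (fun y hy x hxy => by
      rw [hM', Real.sqrt_lt' hr] at hxy
      have h1 := hhg x.1 y.1 (x.2 - y.2) hxy
      have h2 : y.2 ≤ h y.1 := hy
      show x.2 ≤ g x.1
      linarith)
    ((measureReal_prod_gaussianReal_subgraph μ hh).trans hc)
  rwa [measureReal_prod_gaussianReal_subgraph μ hg] at this

end GaussianProduct

section FunctionalInequality

open Filter Topology Set Metric

theorem exists_enlargement_le {E : Type*} [NormedAddCommGroup E] [NormedSpace ℝ E]
    {M : Seminorm ℝ E} {C : ℝ} (hC : 0 < C) (hMC : ∀ x, ‖x‖ ≤ C * M x) {h : E → ℝ}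
    (hh : Differentiable ℝ h) (hh' : UniformContinuous (fderiv ℝ h)) {D : E → ℝ}
    (hD : ∀ x w, fderiv ℝ h x w ≤ D x * M w) {ε : ℝ} (hε : 0 < ε) :
    ∃ r₀ > 0, ∀ r, 0 < r → r < r₀ → ∀ x y t, M (x - y) ^ 2 + t ^ 2 < r ^ 2 →
      h y + t ≤ h x + r * (√(1 + D x ^ 2) + ε) := by
  obtain ⟨δ, hδ, hδ'⟩ := Metric.uniformContinuous_iff.1 hh' (ε / C) (by positivity)
  refine ⟨δ / C, by positivity, fun r hr hrδ x y t hxy => ?_⟩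
  have hm0 : 0 ≤ M (y - x) := apply_nonneg _ _
  rw [map_sub_rev] at hxy
  have hm : M (y - x) < r := lt_of_pow_lt_pow_left₀ 2 hr.le (by nlinarith)
  rw [lt_div_iff₀ hC] at hrδ
  have hdist : ‖y - x‖ < δ := by nlinarith [hMC (y - x)]
  have h1 := (convex_ball x δ).norm_image_sub_le_of_norm_hasFDerivWithin_le' (f := h)
    (fun z _ => (hh z).hasFDerivAt.hasFDerivWithinAt) (φ := fderiv ℝ h x) (C := ε / C)
    (fun z hz => by rw [← dist_eq_norm]; exact (hδ' hz).le) (mem_ball_self hδ)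
    (y := y) (by rwa [mem_ball, dist_eq_norm])
  have h2 : ε / C * ‖y - x‖ ≤ ε * r := by
    rw [div_mul_eq_mul_div, div_le_iff₀ hC]
    nlinarith [hMC (y - x), mul_le_mul_of_nonneg_left hm.le hC.le]
  have h3 : D x * M (y - x) + t ≤ √(1 + D x ^ 2) * r := by
    refine le_of_sq_le_sq ?_ (by positivity)
    rw [mul_pow, Real.sq_sqrt (by positivity)]
    nlinarith [sq_nonneg (D x * t - M (y - x)), sq_nonneg (D x)]
  have h4 := (le_abs_self _).trans h1
  linarith [hD x (y - x)]

theorem gaussPDF_le_integral_of_gaussCDF_add_le {E : Type*} [TopologicalSpace E]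
    [MeasurableSpace E] [OpensMeasurableSpace E] {μ : Measure E} [IsProbabilityMeasure μ]
    {h s : E → ℝ} (hh : Continuous h) (hs : Continuous s) (hs0 : ∀ x, 0 ≤ s x) {S : ℝ}
    (hsS : ∀ x, s x ≤ S) {c : ℝ} (hc : ∫ x, gaussCDF (h x) ∂μ = gaussCDF c)
    (H : ∀ ε > 0, ∃ r₀ > 0, ∀ r, 0 < r → r < r₀ →
      gaussCDF (c + r) ≤ ∫ x, gaussCDF (h x + r * (s x + ε)) ∂μ) :
    gaussPDF c ≤ ∫ x, gaussPDF (h x) * s x ∂μ := by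
  have hcdf := continuous_gaussCDF
  have hpdf := continuous_gaussPDF
  have hbdd : ∀ {f : E → ℝ}, Continuous f → ∀ B : ℝ, (∀ x, |f x| ≤ B) → Integrable f μ :=
    fun hf B hB => Integrable.of_bound hf.aestronglyMeasurable B (Eventually.of_forall hB)
  have hi1 : Integrable (fun x => gaussCDF (h x)) μ := hbdd (by fun_prop) 1 fun x => by
    rw [abs_of_pos (gaussCDF_pos _)]; exact (gaussCDF_lt_one _).le
  have hps : ∀ x, gaussPDF (h x) * s x ≤ S := fun x =>
    (mul_le_of_le_one_left (hs0 x) (gaussPDF_le_one _)).trans (hsS x)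
  have hi2 : Integrable (fun x => gaussPDF (h x) * s x) μ := hbdd (by fun_prop) S fun x => by
    rw [abs_of_nonneg (mul_nonneg (gaussPDF_pos _).le (hs0 x))]
    exact hps x
  refine le_of_forall_pos_le_add fun ε hε => ?_
  obtain ⟨r₀, hr₀, hr⟩ := H ε hε
  have hlim : Tendsto (fun r : ℝ => ∫ x, gaussPDF (h x) * s x ∂μ + ε + r * (S + ε) ^ 2) (𝓝[>] 0)
      (𝓝 (∫ x, gaussPDF (h x) * s x ∂μ + ε)) := by
    have : Continuous fun r : ℝ => ∫ x, gaussPDF (h x) * s x ∂μ + ε + r * (S + ε) ^ 2 := by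
      fun_prop
    simpa using (this.tendsto 0).mono_left nhdsWithin_le_nhds
  refine le_of_tendsto_of_tendsto (hasDerivAt_gaussCDF c).tendsto_slope_zero_right hlim ?_
  filter_upwards [Ioo_mem_nhdsGT hr₀] with r hr'
  have hr0 := hr'.1
  have hi3 : Integrable (fun x => gaussCDF (h x) + r * (gaussPDF (h x) * s x)) μ :=
    hi1.add (hi2.const_mul r)
  have h1 : ∫ x, gaussCDF (h x + r * (s x + ε)) ∂μ ≤
      ∫ x, (gaussCDF (h x) + r * (gaussPDF (h x) * s x) + (r * ε + r ^ 2 * (S + ε) ^ 2)) ∂μ := by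
    refine integral_mono (hbdd (by fun_prop) 1 fun x => ?_)
      (hi3.add (integrable_const _)) fun x => ?_
    · rw [abs_of_pos (gaussCDF_pos _)]; exact (gaussCDF_lt_one _).le
    · have hsε : 0 ≤ s x + ε := by linarith [hs0 x]
      have h2 := gaussCDF_add_le (h x) (mul_nonneg hr0.le hsε)
      have h3 : (r * (s x + ε)) ^ 2 ≤ r ^ 2 * (S + ε) ^ 2 := by
        rw [mul_pow]
        gcongr
        exact hsS x
      have h4 : r * ε * gaussPDF (h x) ≤ r * ε :=
        mul_le_of_le_one_right (by positivity) (gaussPDF_le_one _)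
      simp only
      nlinarith
  rw [integral_add hi3 (integrable_const _), integral_add hi1 (hi2.const_mul r), integral_const_mul, hc] at h1
  simp only [integral_const, probReal_univ, one_smul] at h1
  have h5 := hr r hr0 hr'.2
  rw [smul_eq_mul, inv_mul_le_iff₀ hr0]
  nlinarith

end FunctionalInequality

section Bobkov

open Filter Topology Set Metric

theorem HasCompactSupport.fun_smul_left {X F : Type*} [TopologicalSpace X] [NormedAddCommGroup F]
    [NormedSpace ℝ F] {f : X → F} (hf : HasCompactSupport f) (g : X → ℝ) :
    HasCompactSupport fun x => g x • f x :=
  hf.mono fun x hx h => hx (by simp only [h, smul_zero])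

theorem continuousOn_invFun_gaussCDF : ContinuousOn (Function.invFun gaussCDF) (Ioo 0 1) := by
  have hemb : IsEmbedding gaussCDF := strictMono_gaussCDF.isEmbedding_of_ordConnected
    (isPreconnected_range continuous_gaussCDF).ordConnected
  rw [hemb.isInducing.continuousOn_iff]
  exact continuousOn_id.congr fun θ hθ => Function.invFun_eq (exists_gaussCDF_eq hθ.1 hθ.2)

theorem hasDerivAt_invFun_gaussCDF {θ : ℝ} (hθ : θ ∈ Ioo (0 : ℝ) 1) :
    HasDerivAt (Function.invFun gaussCDF) (gaussPDF (Function.invFun gaussCDF θ))⁻¹ θ :=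
  (hasDerivAt_gaussCDF _).of_local_left_inverse
    (continuousOn_invFun_gaussCDF.continuousAt (isOpen_Ioo.mem_nhds hθ)) (gaussPDF_pos _).ne'
    (by
      filter_upwards [isOpen_Ioo.mem_nhds hθ] with η hη
      exact Function.invFun_eq (exists_gaussCDF_eq hη.1 hη.2))

theorem IsAsymmetricNorm.sqrt_mul_gaussIsop_le_of_mem_Ioo {n : ℕ} {Nm : (Fin n → ℝ) → ℝ}
    (hN : IsAsymmetricNorm Nm) {K : ℝ} (hK : 0 < K) {Φ : (Fin n → ℝ) → ℝ} (hΦc : Continuous Φ)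
    (hΦ : ∀ x y : Fin n → ℝ, ∀ l : ℝ, l ∈ Ioo (0 : ℝ) 1 → Φ ((1 - l) • x + l • y) ≤
      (1 - l) * Φ x + l * Φ y - K / 2 * (1 - l) * l * Nm (y - x) ^ 2)
    {μ : Measure (Fin n → ℝ)} [IsProbabilityMeasure μ]
    (hμ : μ = volume.withDensity fun x => ENNReal.ofReal (Real.exp (-Φ x)))
    {u : (Fin n → ℝ) → ℝ} (hu : ContDiff ℝ 1 u) (hu' : HasCompactSupport (fderiv ℝ u))
    (hu01 : ∀ x, u x ∈ Ioo (0 : ℝ) 1) :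
    √K * gaussIsop (∫ x, u x ∂μ) ≤
      ∫ x, √(K * gaussIsop (u x) ^ 2 + dualNorm Nm (fderiv ℝ u x) ^ 2) ∂μ := by
  have hsK : 0 < √K := Real.sqrt_pos.2 hK
  have hN' : IsAsymmetricNorm fun x => √K * Nm x :=
    { continuous := hN.continuous.const_mul _
      pos := fun x hx => mul_pos hsK (hN.pos x hx)
      smul := fun c hc x => by rw [hN.smul c hc x]; ring
      add_le := fun x y => by
        rw [← mul_add]
        exact mul_le_mul_of_nonneg_left (hN.add_le x y) hsK.le }
  obtain ⟨M, hM⟩ := hN'.exists_seminorm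
  obtain ⟨C, hC, hCN⟩ := hN'.exists_norm_le_mul
  have hMc : Continuous M := by
    rw [show (M : (Fin n → ℝ) → ℝ) = _ from funext hM]
    have := hN.continuous
    fun_prop
  have hNM : ∀ x, √K * Nm x ≤ M x := fun x => by rw [hM]; exact le_max_left _ _
  have hMpos : ∀ x ≠ 0, 0 < M x := fun x hx => (hN'.pos x hx).trans_le (hNM x)
  have hΦM : IsUniformlyConvexWrt M Φ := by
    intro x y l h0 h1
    have key : M (y - x) = √K * Nm (y - x) ∨ M (y - x) = √K * Nm (x - y) := by
      rw [hM, neg_sub]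
      exact max_choice _ _
    rcases key with h | h
    · rw [h, mul_pow, Real.sq_sqrt hK.le]
      linarith [hΦ x y l ⟨h0, h1⟩]
    · rw [h, mul_pow, Real.sq_sqrt hK.le]
      have := hΦ y x (1 - l) ⟨by linarith, by linarith⟩
      rw [sub_sub_cancel, add_comm (l • y)] at this
      linarith
  set h : (Fin n → ℝ) → ℝ := fun x => Function.invFun gaussCDF (u x) with hh
  have hhu : ∀ x, gaussCDF (h x) = u x := fun x =>
    Function.invFun_eq (exists_gaussCDF_eq (hu01 x).1 (hu01 x).2)
  have hud : Differentiable ℝ u := hu.differentiable one_ne_zero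
  have hhd : ∀ x, HasFDerivAt h ((gaussPDF (h x))⁻¹ • fderiv ℝ u x) x := fun x =>
    (hasDerivAt_invFun_gaussCDF (hu01 x)).comp_hasFDerivAt x (hud x).hasFDerivAt
  have hhdiff : Differentiable ℝ h := fun x => (hhd x).differentiableAt
  have hhc := hhdiff.continuous
  have hfd : fderiv ℝ h = fun x => (gaussPDF (h x))⁻¹ • fderiv ℝ u x :=
    funext fun x => (hhd x).fderiv
  have hfdc : Continuous (fderiv ℝ h) := by
    rw [hfd]
    exact ((continuous_gaussPDF.comp hhc).inv₀ fun x => (gaussPDF_pos _).ne').smul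
      (hu.continuous_fderiv one_ne_zero)
  have hfds : HasCompactSupport (fderiv ℝ h) := by
    rw [hfd]
    exact hu'.fun_smul_left _
  have hN0 : dualNorm Nm 0 = 0 := le_antisymm (hN.dualNorm_le fun x _ => by simp)
    (hN.dualNorm_nonneg 0)
  set D : (Fin n → ℝ) → ℝ := fun x => dualNorm Nm (fderiv ℝ h x) / √K with hDdef
  have hDc : Continuous D := (hN.continuous_dualNorm.comp hfdc).div_const _
  obtain ⟨S, hS⟩ := hDc.bounded_above_of_compact_support
    (hfds.comp_left (g := fun α => dualNorm Nm α / √K) (by simp [hN0]))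
  have hD0 : ∀ x, 0 ≤ D x := fun x => div_nonneg (hN.dualNorm_nonneg _) hsK.le
  have hDle : ∀ x w, fderiv ℝ h x w ≤ D x * M w := fun x w => by
    calc fderiv ℝ h x w ≤ dualNorm Nm (fderiv ℝ h x) * Nm w := hN.apply_le_dualNorm_mul _ w
      _ = D x * (√K * Nm w) := by rw [hDdef]; field_simp
      _ ≤ D x * M w := mul_le_mul_of_nonneg_left (hNM w) (hD0 x)
  have hui : Integrable u μ := Integrable.of_bound hud.continuous.aestronglyMeasurable 1
    (Eventually.of_forall fun x => by
      rw [Real.norm_of_nonneg (hu01 x).1.le]; exact (hu01 x).2.le)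
  obtain ⟨c, hc⟩ : ∃ c, gaussCDF c = ∫ x, u x ∂μ := by
    refine exists_gaussCDF_eq ?_ ?_
    · rw [integral_pos_iff_support_of_nonneg (fun x => (hu01 x).1.le) hui,
        show Function.support u = univ from eq_univ_of_forall fun x => (hu01 x).1.ne']
      simp
    · have : 0 < ∫ x, (1 - u x) ∂μ := by
        rw [integral_pos_iff_support_of_nonneg (fun x => sub_nonneg.2 (hu01 x).2.le)
          ((integrable_const 1).sub hui), show Function.support (fun x => 1 - u x) = univ from
            eq_univ_of_forall fun x => (sub_pos.2 (hu01 x).2).ne']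
        simp
      rw [integral_sub (integrable_const 1) hui] at this
      simpa using this
  have hc' : ∫ x, gaussCDF (h x) ∂μ = gaussCDF c := by simp_rw [hhu, hc]
  have main := gaussPDF_le_integral_of_gaussCDF_add_le (μ := μ) hhc
    (s := fun x => √(1 + D x ^ 2)) (by fun_prop) (fun x => Real.sqrt_nonneg _)
    (S := √(1 + S ^ 2)) (fun x => by
      have := hS x
      rw [Real.norm_of_nonneg (hD0 x)] at this
      have := hD0 x
      gcongr) hc' (fun ε hε => by
      obtain ⟨r₀, hr₀, H⟩ := exists_enlargement_le hC
        (fun x => (hCN x).trans (mul_le_mul_of_nonneg_left (hNM x) hC.le)) hhdiff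
        (hfdc.uniformContinuous_of_tendsto_cocompact hfds.is_zero_at_infty) hDle hε
      exact ⟨r₀, hr₀, fun r hr0 hr => gaussCDF_add_le_integral hMc hMpos hΦc hΦM hμ hhc
        (by fun_prop) hr0 (H r hr0 hr) hc'⟩)
  rw [← hc, gaussIsop_gaussCDF]
  refine (mul_le_mul_of_nonneg_left main hsK.le).trans_eq ?_
  rw [← integral_const_mul]
  congr 1
  ext x
  have hp := gaussPDF_pos (h x)
  have h1 : D x = (gaussPDF (h x))⁻¹ * dualNorm Nm (fderiv ℝ u x) / √K := by
    simp only [hDdef, hfd]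
    rw [hN.dualNorm_smul (inv_pos.2 hp)]
  rw [← hhu x, gaussIsop_gaussCDF, ← mul_assoc, h1]
  refine ((Real.sqrt_eq_iff_eq_sq ?_ ?_).2 ?_).symm
  · positivity
  · positivity
  · rw [mul_pow, mul_pow, Real.sq_sqrt hK.le, Real.sq_sqrt (by positivity), div_pow, mul_pow,
      Real.sq_sqrt hK.le]
    field_simp

/-- **Bobkov inequality** for `C¹` functions whose derivative has compact support. -/
theorem IsAsymmetricNorm.sqrt_mul_gaussIsop_le {n : ℕ} {Nm : (Fin n → ℝ) → ℝ}
    (hN : IsAsymmetricNorm Nm) {K : ℝ} (hK : 0 < K) {Φ : (Fin n → ℝ) → ℝ} (hΦc : Continuous Φ)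
    (hΦ : ∀ x y : Fin n → ℝ, ∀ l : ℝ, l ∈ Ioo (0 : ℝ) 1 → Φ ((1 - l) • x + l • y) ≤
      (1 - l) * Φ x + l * Φ y - K / 2 * (1 - l) * l * Nm (y - x) ^ 2)
    {μ : Measure (Fin n → ℝ)} [IsProbabilityMeasure μ]
    (hμ : μ = volume.withDensity fun x => ENNReal.ofReal (Real.exp (-Φ x)))
    {u : (Fin n → ℝ) → ℝ} (hu : ContDiff ℝ 1 u) (hu' : HasCompactSupport (fderiv ℝ u))
    (hu01 : ∀ x, u x ∈ Icc (0 : ℝ) 1) :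
    √K * gaussIsop (∫ x, u x ∂μ) ≤
      ∫ x, √(K * gaussIsop (u x) ^ 2 + dualNorm Nm (fderiv ℝ u x) ^ 2) ∂μ := by
  have hI := continuous_gaussIsop
  have hud : Differentiable ℝ u := hu.differentiable one_ne_zero
  have huc := hud.continuous
  have hui : Integrable u μ := Integrable.of_bound huc.aestronglyMeasurable 1
    (Eventually.of_forall fun x => by
      rw [Real.norm_of_nonneg (hu01 x).1]; exact (hu01 x).2)
  have hN0 : dualNorm Nm 0 = 0 := le_antisymm (hN.dualNorm_le fun x _ => by simp)
    (hN.dualNorm_nonneg 0)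
  set D : (Fin n → ℝ) → ℝ := fun x => dualNorm Nm (fderiv ℝ u x) with hD
  have hDc : Continuous D := hN.continuous_dualNorm.comp (hu.continuous_fderiv one_ne_zero)
  have hD0 : ∀ x, 0 ≤ D x := fun x => hN.dualNorm_nonneg _
  obtain ⟨S, hS⟩ := hDc.bounded_above_of_compact_support (hu'.comp_left hN0)
  have key : ∀ᶠ η : ℝ in 𝓝[>] 0, √K * gaussIsop (η + (1 - 2 * η) * ∫ x, u x ∂μ) ≤
      ∫ x, √(K * gaussIsop (η + (1 - 2 * η) * u x) ^ 2 + ((1 - 2 * η) * D x) ^ 2) ∂μ := by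
    filter_upwards [Ioo_mem_nhdsGT (show (0 : ℝ) < 1 / 2 by norm_num)] with η hη
    have h0 := hη.1
    have h1 : 0 < 1 - 2 * η := by linarith [hη.2]
    have hfd : ∀ x, fderiv ℝ (fun x => η + (1 - 2 * η) * u x) x = (1 - 2 * η) • fderiv ℝ u x :=
      fun x => (((hud x).hasFDerivAt.const_mul (1 - 2 * η)).const_add η).fderiv
    have := hN.sqrt_mul_gaussIsop_le_of_mem_Ioo hK hΦc hΦ hμ
      (u := fun x => η + (1 - 2 * η) * u x) (by fun_prop)
      (by rw [funext hfd]; exact hu'.fun_smul_left _)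
      (fun x => ⟨by nlinarith [(hu01 x).1], by nlinarith [(hu01 x).2]⟩)
    rw [integral_add (integrable_const _) (hui.const_mul _), integral_const_mul] at this
    simp only [integral_const, probReal_univ, one_smul, hfd, hN.dualNorm_smul h1] at this
    exact this
  have hl : Tendsto (fun η : ℝ => √K * gaussIsop (η + (1 - 2 * η) * ∫ x, u x ∂μ)) (𝓝[>] 0)
      (𝓝 (√K * gaussIsop (∫ x, u x ∂μ))) := by
    have : Continuous fun η : ℝ => √K * gaussIsop (η + (1 - 2 * η) * ∫ x, u x ∂μ) := by
      fun_prop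
    simpa using (this.tendsto 0).mono_left nhdsWithin_le_nhds
  refine le_of_tendsto_of_tendsto hl (tendsto_integral_filter_of_dominated_convergence
    (fun _ => √(K + S ^ 2)) (Eventually.of_forall fun η => ?_) ?_ (integrable_const _)
    (Eventually.of_forall fun x => ?_)) key
  · exact Continuous.aestronglyMeasurable (by fun_prop)
  · filter_upwards [Ioo_mem_nhdsGT (show (0 : ℝ) < 1 / 2 by norm_num)] with η hη
    refine Eventually.of_forall fun x => ?_
    have h0 := hη.1
    have h1 : 0 < 1 - 2 * η := by linarith [hη.2]
    have h2 := hS x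
    rw [Real.norm_of_nonneg (hD0 x)] at h2
    rw [Real.norm_of_nonneg (Real.sqrt_nonneg _)]
    have h3 : (1 - 2 * η) * D x ≤ S := by nlinarith [hD0 x]
    have h4 : gaussIsop (η + (1 - 2 * η) * u x) ^ 2 ≤ 1 :=
      pow_le_one₀ (gaussIsop_nonneg _) (gaussIsop_le_one _)
    have h5 : 0 ≤ (1 - 2 * η) * D x := mul_nonneg h1.le (hD0 x)
    refine Real.sqrt_le_sqrt (add_le_add ?_ (pow_le_pow_left₀ h5 h3 2))
    nlinarith
  · have : Continuous fun η : ℝ =>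
        √(K * gaussIsop (η + (1 - 2 * η) * u x) ^ 2 + ((1 - 2 * η) * D x) ^ 2) := by
      fun_prop
    simpa using (this.tendsto 0).mono_left nhdsWithin_le_nhds

end Bobkov

/-- **Bobkov-type functional inequality on normed spaces.**
Let `Nm` be an asymmetric norm on `ℝⁿ` (`n ≥ 2`), `Φ` continuous and `K`-convex
with `K > 0`, and `𝔪 = e^{-Φ}·Leb` a probability measure. Then for every smooth
compactly supported `u : ℝⁿ → ℝ` with `0 ≤ u ≤ 1`,
`√K·𝒩(∫ u d𝔪) ≤ ∫ √(K·𝒩(u)² + ‖Du‖_*²) d𝔪`. -/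
theorem bobkov_inequality_asymmetric_norm {n : ℕ} (hn : 2 ≤ n)
    (Nm : (Fin n → ℝ) → ℝ) (hNcont : Continuous Nm) (hNnonneg : ∀ x, 0 ≤ Nm x)
    (hNpos : ∀ x : Fin n → ℝ, x ≠ 0 → 0 < Nm x)
    (hNhomog : ∀ c : ℝ, 0 < c → ∀ x : Fin n → ℝ, Nm (c • x) = c * Nm x)
    (hNtriangle : ∀ x y : Fin n → ℝ, Nm (x + y) ≤ Nm x + Nm y)
    (K : ℝ) (hK : 0 < K)
    (Φ : (Fin n → ℝ) → ℝ) (hΦcont : Continuous Φ)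
    (hΦconv : ∀ x y : Fin n → ℝ, ∀ lam : ℝ, lam ∈ Set.Ioo (0 : ℝ) 1 →
      Φ ((1 - lam) • x + lam • y) ≤ (1 - lam) * Φ x + lam * Φ y -
        K / 2 * (1 - lam) * lam * Nm (y - x) ^ 2)
    (𝔪 : Measure (Fin n → ℝ))
    (h𝔪 : 𝔪 = volume.withDensity fun x => ENNReal.ofReal (Real.exp (-Φ x)))
    (hprob : IsProbabilityMeasure 𝔪)
    (u : (Fin n → ℝ) → ℝ) (hu : ContDiff ℝ (⊤ : ℕ∞) u) (husupp : HasCompactSupport u)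
    (hu01 : ∀ x, u x ∈ Set.Icc (0 : ℝ) 1) :
    Real.sqrt K * gaussIsop (∫ x, u x ∂𝔪) ≤
      ∫ x, Real.sqrt (K * gaussIsop (u x) ^ 2 +
        dualNorm Nm (fderiv ℝ u x) ^ 2) ∂𝔪 := by
  have hN : IsAsymmetricNorm Nm := ⟨hNcont, hNpos, hNhomog, hNtriangle⟩
  have hu1 : ContDiff ℝ 1 u := hu.of_le (by exact_mod_cast le_top)
  exact hN.sqrt_mul_gaussIsop_le hK hΦcont hΦconv h𝔪 hu1 (husupp.fderiv ℝ) hu01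
end

section
/- Let (X, 𝔪) be a probability measure space, K > 0, f : X → ℝ a bounded measurable function with ∫_X f d𝔪 = 0 and 0 < M where M is an essential upper bound of |f|, and G : X → [0,∞) an integrable function. Suppose that for every ε ∈ (0, 1/M) the entropy inequality ∫_X (1+εf) log(1+εf) d𝔪 ≤ (ε²/(2K)) ∫_X G/(1+εf) d𝔪 holds. Then ∫_X f² d𝔪 ≤ (1/K) ∫_X G d𝔪. -/
open MeasureTheory

/-- Quantitative second-order lower bound for `(1 + t) log (1 + t)` near `0`. -/
theorem one_add_mul_log_one_add_ge {t : ℝ} (ht : |t| ≤ 1 / 2) :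
    t + t ^ 2 / 2 - 4 * |t| * t ^ 2 ≤ (1 + t) * Real.log (1 + t) := by
  have h := Real.abs_log_sub_add_sum_range_le (x := -t) (by rw [abs_neg]; linarith) 2
  simp only [Finset.sum_range_succ, Finset.sum_range_zero, abs_neg, sub_neg_eq_add] at h
  norm_num at h
  have hb : |t| ^ 3 / (1 - |t|) ≤ 2 * |t| ^ 3 := by
    rw [div_le_iff₀ (by linarith)]
    nlinarith [pow_nonneg (abs_nonneg t) 3]
  have hlog : t - t ^ 2 / 2 - 2 * |t| ^ 3 ≤ Real.log (1 + t) := by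
    linarith [(abs_le.mp (h.trans hb)).1]
  have hcube : |t| ^ 3 = |t| * t ^ 2 := by rw [← sq_abs t]; ring
  have hnn : 0 ≤ |t| * t ^ 2 := by positivity
  obtain ⟨h1, h2⟩ := abs_le.mp ht
  have hmul := mul_le_mul_of_nonneg_left hlog (by linarith : (0 : ℝ) ≤ 1 + t)
  rw [hcube] at hmul
  have ht3 : t * t ^ 2 ≤ |t| * t ^ 2 :=
    mul_le_mul_of_nonneg_right (le_abs_self t) (sq_nonneg t)
  nlinarith [mul_nonneg (by linarith : (0 : ℝ) ≤ 1 / 2 - t) hnn]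

/-- The function `(1 + t) log (1 + t)` is bounded by `2` for `|t| ≤ 1 / 2`. -/
theorem abs_one_add_mul_log_one_add_le {t : ℝ} (ht : |t| ≤ 1 / 2) :
    |(1 + t) * Real.log (1 + t)| ≤ 2 := by
  obtain ⟨h1, h2⟩ := abs_le.mp ht
  have hsq : t ^ 2 ≤ 1 / 4 := by nlinarith
  refine abs_le.mpr ⟨?_, ?_⟩
  · have hlow := one_add_mul_log_one_add_ge ht
    nlinarith [mul_le_mul ht hsq (sq_nonneg t) (by norm_num), sq_nonneg t]
  · have hup := Real.log_le_sub_one_of_pos (by linarith : 0 < 1 + t)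
    nlinarith [mul_le_mul_of_nonneg_left hup (by linarith : (0 : ℝ) ≤ 1 + t)]

/-- **Entropy-to-variance step in the Poincaré inequality.**
On a probability space, if `f` is bounded measurable with `∫ f = 0` and essential
bound `M > 0`, `G ≥ 0` is integrable, and for all `ε ∈ (0, 1/M)` the entropy
inequality `∫ (1+εf) log(1+εf) ≤ (ε²/(2K)) ∫ G/(1+εf)` holds, then
`∫ f² ≤ (1/K) ∫ G`. -/
theorem variance_le_of_entropy_ineq {X : Type*} [MeasurableSpace X]
    (μ : Measure X) [IsProbabilityMeasure μ] (K M : ℝ) (hK : 0 < K) (hM : 0 < M)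
    (f : X → ℝ) (hf : Measurable f) (hfM : ∀ᵐ x ∂μ, |f x| ≤ M)
    (hf0 : ∫ x, f x ∂μ = 0)
    (G : X → ℝ) (hGint : Integrable G μ) (hGnonneg : ∀ x, 0 ≤ G x)
    (hent : ∀ ε ∈ Set.Ioo (0 : ℝ) (1 / M),
      ∫ x, (1 + ε * f x) * Real.log (1 + ε * f x) ∂μ ≤
        ε ^ 2 / (2 * K) * ∫ x, G x / (1 + ε * f x) ∂μ) :
    ∫ x, (f x) ^ 2 ∂μ ≤ (1 / K) * ∫ x, G x ∂μ := by
  have hfint : Integrable f μ := Integrable.of_bound hf.aestronglyMeasurable M hfM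
  have hf2int : Integrable (fun x => f x ^ 2) μ := by
    refine Integrable.of_bound (hf.pow_const 2).aestronglyMeasurable (M ^ 2) ?_
    filter_upwards [hfM] with x hx
    rw [Real.norm_eq_abs, abs_pow]
    exact pow_le_pow_left₀ (abs_nonneg _) hx 2
  have hkey : ∀ s ∈ Set.Ioo (0 : ℝ) (1 / 2),
      (1 - s) * ((1 - 8 * s) * ∫ x, f x ^ 2 ∂μ) ≤ 1 / K * ∫ x, G x ∂μ := by
    rintro s ⟨hs0, hs1⟩
    obtain ⟨ε, hε⟩ : ∃ ε, ε = s / M := ⟨_, rfl⟩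
    have hε0 : 0 < ε := hε ▸ div_pos hs0 hM
    have hεM : ε * M = s := by rw [hε, div_mul_cancel₀ _ hM.ne']
    have hent' := hent ε ⟨hε0, by rw [lt_div_iff₀ hM]; linarith⟩
    have hsmall : ∀ᵐ x ∂μ, |ε * f x| ≤ s := by
      filter_upwards [hfM] with x hx
      rw [abs_mul, abs_of_pos hε0, ← hεM]
      exact mul_le_mul_of_nonneg_left hx hε0.le
    have hentint : Integrable (fun x => (1 + ε * f x) * Real.log (1 + ε * f x)) μ := by
      refine Integrable.of_bound (by fun_prop) 2 ?_
      filter_upwards [hsmall] with x hx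
      exact abs_one_add_mul_log_one_add_le (hx.trans hs1.le)
    have hlow : ε ^ 2 / 2 * (1 - 8 * s) * ∫ x, f x ^ 2 ∂μ ≤
        ∫ x, (1 + ε * f x) * Real.log (1 + ε * f x) ∂μ := by
      calc ε ^ 2 / 2 * (1 - 8 * s) * ∫ x, f x ^ 2 ∂μ
          = ∫ x, (ε * f x + ε ^ 2 / 2 * (1 - 8 * s) * f x ^ 2) ∂μ := by
            rw [integral_add (hfint.const_mul _) (hf2int.const_mul _),
              integral_const_mul, integral_const_mul, hf0]
            ring
        _ ≤ _ := by
            refine integral_mono_ae ((hfint.const_mul _).add (hf2int.const_mul _)) hentint ?_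
            filter_upwards [hsmall] with x hx
            have h1 := one_add_mul_log_one_add_ge (hx.trans hs1.le)
            have h2 := mul_le_mul_of_nonneg_right hx (sq_nonneg (ε * f x))
            linarith
    have hup : ∫ x, G x / (1 + ε * f x) ∂μ ≤ (∫ x, G x ∂μ) / (1 - s) := by
      rw [← integral_div]
      refine integral_mono_of_nonneg ?_ (hGint.div_const _) ?_
      · filter_upwards [hsmall] with x hx
        exact div_nonneg (hGnonneg x) (by linarith [(abs_le.mp hx).1])
      · filter_upwards [hsmall] with x hx
        exact div_le_div_of_nonneg_left (hGnonneg x) (by linarith)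
          (by linarith [(abs_le.mp hx).1])
    have hall := (hlow.trans hent').trans
      (mul_le_mul_of_nonneg_left hup (by positivity : 0 ≤ ε ^ 2 / (2 * K)))
    have h1s : 0 < 1 - s := by linarith
    have hε2 : 0 < ε ^ 2 / 2 := by positivity
    have hdiv : (1 - 8 * s) * ∫ x, f x ^ 2 ∂μ ≤ (1 / K * ∫ x, G x ∂μ) / (1 - s) := by
      refine le_of_mul_le_mul_left ?_ hε2
      calc _ = _ := (mul_assoc _ _ _).symm
        _ ≤ _ := hall
        _ = _ := by field_simp
    rw [le_div_iff₀ h1s] at hdiv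
    linarith
  have hlim : Filter.Tendsto (fun s : ℝ => (1 - s) * ((1 - 8 * s) * ∫ x, f x ^ 2 ∂μ))
      (nhdsWithin 0 (Set.Ioi 0)) (nhds (∫ x, f x ^ 2 ∂μ)) := by
    have hc : Continuous fun s : ℝ => (1 - s) * ((1 - 8 * s) * ∫ x, f x ^ 2 ∂μ) := by
      fun_prop
    simpa using (hc.tendsto 0).mono_left nhdsWithin_le_nhds
  refine le_of_tendsto hlim ?_
  filter_upwards [Ioo_mem_nhdsGT (by norm_num : (0 : ℝ) < 1 / 2)] with s hs
  exact hkey s hs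
end

section
/- Let μ be a σ-finite measure on a measurable space X and let P : L²(μ) → L²(μ) be a continuous linear operator which is positivity preserving (if f ≥ 0 μ-a.e. then P f ≥ 0 μ-a.e.) and sub-Markovian (if 0 ≤ h ≤ 1 μ-a.e. then P h ≤ 1 μ-a.e.). Then for every f ∈ L²(μ) which is μ-essentially bounded, the Jensen-type inequality (P f)² ≤ P(f²) holds μ-almost everywhere. -/
open MeasureTheory

/-- The tangent-line bound `2 q P f - q² ≤ P (f²)`: the function
`h = (1 - (1 - f / q)²)⁺` is in `L²`, satisfies `0 ≤ h ≤ 1` and `2 q f - q² h ≤ f²`. -/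
theorem two_mul_apply_sub_sq_le_of_posPreserving_subMarkov {X : Type*} [MeasurableSpace X]
    {μ : Measure X} (P : Lp ℝ 2 μ →L[ℝ] Lp ℝ 2 μ)
    (hpos : ∀ f : Lp ℝ 2 μ, (∀ᵐ x ∂μ, 0 ≤ f x) → ∀ᵐ x ∂μ, 0 ≤ P f x)
    (hsub : ∀ h : Lp ℝ 2 μ, (∀ᵐ x ∂μ, 0 ≤ h x) → (∀ᵐ x ∂μ, h x ≤ 1) →
      ∀ᵐ x ∂μ, P h x ≤ 1)
    (f g : Lp ℝ 2 μ) (hg : ∀ᵐ x ∂μ, g x = (f x) ^ 2) (q : ℝ) :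
    ∀ᵐ x ∂μ, 2 * q * P f x - q ^ 2 ≤ P g x := by
  let u : Lp ℝ 2 μ := (2 * q⁻¹) • f - (q⁻¹ ^ 2) • g
  let h : Lp ℝ 2 μ := Lp.posPart u
  have hh : ∀ᵐ x ∂μ, h x = max (2 * q⁻¹ * f x - q⁻¹ ^ 2 * (f x) ^ 2) 0 := by
    filter_upwards [Lp.coeFn_posPart u, Lp.coeFn_sub ((2 * q⁻¹) • f) ((q⁻¹ ^ 2) • g),
      Lp.coeFn_smul (2 * q⁻¹) f, Lp.coeFn_smul (q⁻¹ ^ 2) g, hg] with x h1 h2 h3 h4 h5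
    rw [h1, h2, Pi.sub_apply, h3, h4, Pi.smul_apply, Pi.smul_apply, h5, smul_eq_mul, smul_eq_mul]
  have hPh : ∀ᵐ x ∂μ, P h x ≤ 1 := by
    refine hsub h ?_ ?_
    · filter_upwards [hh] with x hx
      rw [hx]
      exact le_max_right _ _
    · filter_upwards [hh] with x hx
      rw [hx]
      exact max_le (by nlinarith [sq_nonneg (1 - q⁻¹ * f x)]) zero_le_one
  have key (a b c : Lp ℝ 2 μ) : ∀ᵐ x ∂μ,
      (a - (2 * q) • b + (q ^ 2) • c : Lp ℝ 2 μ) x = a x - 2 * q * b x + q ^ 2 * c x := by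
    filter_upwards [Lp.coeFn_add (a - (2 * q) • b) ((q ^ 2) • c), Lp.coeFn_sub a ((2 * q) • b),
      Lp.coeFn_smul (2 * q) b, Lp.coeFn_smul (q ^ 2) c] with x h1 h2 h3 h4
    rw [h1, Pi.add_apply, h2, Pi.sub_apply, h3, h4, Pi.smul_apply, Pi.smul_apply, smul_eq_mul,
      smul_eq_mul]
  have hP := hpos (g - (2 * q) • f + (q ^ 2) • h) (by
    filter_upwards [key g f h, hh, hg] with x h1 h2 h3
    rw [h1, h2, h3]
    rcases eq_or_ne q 0 with rfl | hq
    · simp [sq_nonneg]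
    · have h4 := mul_le_mul_of_nonneg_left
        (le_max_left (2 * q⁻¹ * f x - q⁻¹ ^ 2 * (f x) ^ 2) 0) (sq_nonneg q)
      have h5 : q ^ 2 * (2 * q⁻¹ * f x - q⁻¹ ^ 2 * (f x) ^ 2) = 2 * q * f x - (f x) ^ 2 := by
        field_simp
      linarith)
  rw [map_add, map_sub, map_smul, map_smul] at hP
  filter_upwards [hP, hPh, key (P g) (P f) (P h)] with x h1 h2 h3
  rw [h3] at h1
  nlinarith [mul_le_mul_of_nonneg_left h2 (sq_nonneg q)]

/-- **Jensen-type inequality for positivity-preserving sub-Markovian operators.**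
Let `P : L²(μ) → L²(μ)` be a continuous linear operator which is positivity
preserving and sub-Markovian. Then for every essentially bounded `f ∈ L²(μ)`,
`(P f)² ≤ P (f²)` holds `μ`-almost everywhere (where `g ∈ L²(μ)` represents `f²`). -/
theorem sq_apply_le_of_posPreserving_subMarkov {X : Type*} [MeasurableSpace X]
    (μ : Measure X) [SigmaFinite μ]
    (P : Lp ℝ 2 μ →L[ℝ] Lp ℝ 2 μ)
    (hpos : ∀ f : Lp ℝ 2 μ, (∀ᵐ x ∂μ, 0 ≤ f x) → ∀ᵐ x ∂μ, 0 ≤ P f x)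
    (hsub : ∀ h : Lp ℝ 2 μ, (∀ᵐ x ∂μ, 0 ≤ h x) → (∀ᵐ x ∂μ, h x ≤ 1) →
      ∀ᵐ x ∂μ, P h x ≤ 1)
    (f : Lp ℝ 2 μ) (C : ℝ) (hfC : ∀ᵐ x ∂μ, |f x| ≤ C)
    (g : Lp ℝ 2 μ) (hg : ∀ᵐ x ∂μ, g x = (f x) ^ 2) :
    ∀ᵐ x ∂μ, (P f x) ^ 2 ≤ P g x := by
  have hq : ∀ᵐ x ∂μ, ∀ q : ℚ, 2 * (q : ℝ) * P f x - (q : ℝ) ^ 2 ≤ P g x :=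
    ae_all_iff.2 fun q =>
      two_mul_apply_sub_sq_le_of_posPreserving_subMarkov P hpos hsub f g hg q
  filter_upwards [hq] with x hx
  have hreal : 2 * P f x * P f x - (P f x) ^ 2 ≤ P g x :=
    Rat.isDenseEmbedding_coe_real.dense.induction_on
      (p := fun r : ℝ => 2 * r * P f x - r ^ 2 ≤ P g x) (P f x)
      (isClosed_le (by fun_prop) continuous_const) hx
  linarith [sq (P f x)]
end

section
/- Let n ≥ 2 and let F : ℝⁿ → [0,∞) be a Minkowski norm, i.e. F is C^∞ on ℝⁿ \ {0}, F(cv) = cF(v) for all c ≥ 0 and v ∈ ℝⁿ, and for every v ≠ 0 the symmetric bilinear form g_v(w₁,w₂) := (1/2)·D²(F²)(v)[w₁,w₂] (half the second Fréchet derivative of F² at v) is positive definite. Let S ≥ 1 and C ≥ 1 be constants. (i) If g_v(w,w) ≤ S·F(w)² for all v, w ∈ ℝⁿ \ {0}, then F(v)² ≤ S·F(−v)² for all v ∈ ℝⁿ. (ii) If F(w)² ≤ C·g_v(w,w) for all v, w ∈ ℝⁿ \ {0}, then F(v)² ≤ C·F(−v)² for all v ∈ ℝⁿ. Consequently the reversibility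 constant Λ_F := sup_{v≠0} F(v)/F(−v) satisfies Λ_F ≤ min{√S, √C}. -/
/-- The fundamental tensor `g_v(w₁,w₂) := (1/2)·D²(F²)(v)[w₁,w₂]`,
half the second Fréchet derivative of `F²` at `v`. -/
noncomputable def fundamentalTensor {n : ℕ} (F : (Fin n → ℝ) → ℝ)
    (v w₁ w₂ : Fin n → ℝ) : ℝ :=
  (1 / 2) * fderiv ℝ (fderiv ℝ (fun x => F x ^ 2)) v w₁ w₂

/-- Euler's identity for a function that is positively `k`-homogeneous along the ray of `v`. -/
theorem fderiv_apply_self_of_posHomogeneous {E G : Type*} [NormedAddCommGroup E] [NormedSpace ℝ E]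
    [NormedAddCommGroup G] [NormedSpace ℝ G] {f : E → G} {v : E} {k : ℕ}
    (hf : DifferentiableAt ℝ f v) (hhom : ∀ c : ℝ, 0 < c → f (c • v) = c ^ k • f v) :
    fderiv ℝ f v v = (k : ℝ) • f v := by
  have hray : HasDerivAt (fun c : ℝ => c • v) v 1 := by
    simpa using (hasDerivAt_id (1 : ℝ)).smul_const v
  have hcomp : HasDerivAt (fun c : ℝ => f (c • v)) (fderiv ℝ f v v) 1 := by
    refine HasFDerivAt.comp_hasDerivAt (1 : ℝ) (l := f) ?_ hray
    simpa using hf.hasFDerivAt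
  have hpow : HasDerivAt (fun c : ℝ => c ^ k • f v) ((k : ℝ) • f v) 1 := by
    simpa using (hasDerivAt_pow k (1 : ℝ)).smul_const (f v)
  refine hcomp.unique (hpow.congr_of_eventuallyEq ?_)
  filter_upwards [lt_mem_nhds (zero_lt_one' ℝ)] with c hc using hhom c hc

/-- The derivative of a positively `(k + 1)`-homogeneous function is positively `k`-homogeneous. -/
theorem fderiv_smul_of_posHomogeneous {E G : Type*} [NormedAddCommGroup E] [NormedSpace ℝ E]
    [NormedAddCommGroup G] [NormedSpace ℝ G] {f : E → G} {k : ℕ}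
    (hhom : ∀ c : ℝ, 0 < c → ∀ v, f (c • v) = c ^ (k + 1) • f v) {c : ℝ} (hc : 0 < c) (v : E) :
    fderiv ℝ f (c • v) = c ^ k • fderiv ℝ f v := by
  have h : c • fderiv ℝ f (c • v) = c ^ (k + 1) • fderiv ℝ f v := by
    rw [← fderiv_comp_smul, funext (hhom c hc)]
    exact congrFun (fderiv_const_smul_field (𝕜 := ℝ) (f := f) (c ^ (k + 1))) v
  rw [pow_succ', mul_smul] at h
  exact smul_right_injective _ hc.ne' h

/-- The identity `g_v(v,v) = F(v)²`. -/
theorem fundamentalTensor_self {n : ℕ} {F : (Fin n → ℝ) → ℝ}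
    (hFsmooth : ContDiffOn ℝ (⊤ : ℕ∞) F {(0 : Fin n → ℝ)}ᶜ)
    (hFhomog : ∀ c : ℝ, 0 ≤ c → ∀ v : Fin n → ℝ, F (c • v) = c * F v)
    {v : Fin n → ℝ} (hv : v ≠ 0) : fundamentalTensor F v v v = F v ^ 2 := by
  have hhom : ∀ c : ℝ, 0 < c → ∀ x, F (c • x) ^ 2 = c ^ (1 + 1) • F x ^ 2 := by
    intro c hc x
    rw [hFhomog c hc.le, smul_eq_mul, mul_pow]
  have hsq : ContDiffAt ℝ (⊤ : ℕ∞) (fun x => F x ^ 2) v :=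
    (hFsmooth.contDiffAt (isOpen_compl_singleton.mem_nhds hv)).pow 2
  have hdsq : DifferentiableAt ℝ (fderiv ℝ fun x => F x ^ 2) v :=
    (hsq.fderiv_right (m := 1) (WithTop.coe_le_coe.2 le_top)).differentiableAt one_ne_zero
  have h₁ := fderiv_apply_self_of_posHomogeneous (hsq.differentiableAt (by simp))
    fun c hc => hhom c hc v
  have h₂ := fderiv_apply_self_of_posHomogeneous hdsq
    fun c hc => fderiv_smul_of_posHomogeneous hhom hc v
  rw [fundamentalTensor, h₂]
  simp [h₁]

/-- The quadratic form `g_v(w,w)` is even in `w`. -/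
theorem fundamentalTensor_neg_neg {n : ℕ} (F : (Fin n → ℝ) → ℝ) (v w : Fin n → ℝ) :
    fundamentalTensor F v (-w) (-w) = fundamentalTensor F v w w := by
  simp [fundamentalTensor]

/-- If `F(v)² ≤ K·F(−v)²` for all `v`, then `Λ_F ≤ √K`. -/
theorem sSup_div_neg_le_sqrt {n : ℕ} {F : (Fin n → ℝ) → ℝ} (hFnonneg : ∀ v, 0 ≤ F v) {K : ℝ}
    (hK : 0 ≤ K) (h : ∀ v, F v ^ 2 ≤ K * F (-v) ^ 2) :
    sSup {r : ℝ | ∃ v : Fin n → ℝ, v ≠ 0 ∧ r = F v / F (-v)} ≤ Real.sqrt K := by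
  refine Real.sSup_le ?_ (Real.sqrt_nonneg K)
  rintro _ ⟨v, -, rfl⟩
  refine div_le_of_le_mul₀ (hFnonneg _) (Real.sqrt_nonneg K) ?_
  refine le_of_sq_le_sq ?_ (mul_nonneg (Real.sqrt_nonneg K) (hFnonneg _))
  rw [mul_pow, Real.sq_sqrt hK]
  exact h v

/-- For a Minkowski norm `F` on `ℝⁿ`:
(i) if `g_v(w,w) ≤ S·F(w)²` for all `v,w ≠ 0` then `F(v)² ≤ S·F(−v)²`;
(ii) if `F(w)² ≤ C·g_v(w,w)` for all `v,w ≠ 0` then `F(v)² ≤ C·F(−v)²`;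
consequently the reversibility constant `Λ_F = sup_{v≠0} F(v)/F(−v)`
satisfies `Λ_F ≤ min{√S, √C}`. -/
theorem reversibility_le_of_uniform_smoothness_convexity {n : ℕ} (hn : 2 ≤ n)
    (F : (Fin n → ℝ) → ℝ) (hFnonneg : ∀ v, 0 ≤ F v)
    (hFsmooth : ContDiffOn ℝ (⊤ : ℕ∞) F {(0 : Fin n → ℝ)}ᶜ)
    (hFhomog : ∀ c : ℝ, 0 ≤ c → ∀ v : Fin n → ℝ, F (c • v) = c * F v)
    (hFposdef : ∀ v : Fin n → ℝ, v ≠ 0 → ∀ w : Fin n → ℝ, w ≠ 0 →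
      0 < fundamentalTensor F v w w)
    (S C : ℝ) (hS : 1 ≤ S) (hC : 1 ≤ C) :
    ((∀ v : Fin n → ℝ, v ≠ 0 → ∀ w : Fin n → ℝ, w ≠ 0 →
        fundamentalTensor F v w w ≤ S * F w ^ 2) →
      ∀ v : Fin n → ℝ, F v ^ 2 ≤ S * F (-v) ^ 2) ∧
    ((∀ v : Fin n → ℝ, v ≠ 0 → ∀ w : Fin n → ℝ, w ≠ 0 →
        F w ^ 2 ≤ C * fundamentalTensor F v w w) →
      ∀ v : Fin n → ℝ, F v ^ 2 ≤ C * F (-v) ^ 2) ∧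
    ((∀ v : Fin n → ℝ, v ≠ 0 → ∀ w : Fin n → ℝ, w ≠ 0 →
        fundamentalTensor F v w w ≤ S * F w ^ 2) →
      (∀ v : Fin n → ℝ, v ≠ 0 → ∀ w : Fin n → ℝ, w ≠ 0 →
        F w ^ 2 ≤ C * fundamentalTensor F v w w) →
      sSup {r : ℝ | ∃ v : Fin n → ℝ, v ≠ 0 ∧ r = F v / F (-v)} ≤
        min (Real.sqrt S) (Real.sqrt C)) := by
  have hF0 : F 0 = 0 := by simpa using hFhomog 0 le_rfl 0
  have hsmooth : (∀ v : Fin n → ℝ, v ≠ 0 → ∀ w : Fin n → ℝ, w ≠ 0 →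
      fundamentalTensor F v w w ≤ S * F w ^ 2) → ∀ v : Fin n → ℝ, F v ^ 2 ≤ S * F (-v) ^ 2 := by
    intro h v
    rcases eq_or_ne v 0 with rfl | hv
    · simp [hF0]
    · rw [← fundamentalTensor_self hFsmooth hFhomog hv, ← fundamentalTensor_neg_neg]
      exact h v hv (-v) (neg_ne_zero.2 hv)
  have hconvex : (∀ v : Fin n → ℝ, v ≠ 0 → ∀ w : Fin n → ℝ, w ≠ 0 →
      F w ^ 2 ≤ C * fundamentalTensor F v w w) → ∀ v : Fin n → ℝ, F v ^ 2 ≤ C * F (-v) ^ 2 := by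
    intro h v
    rcases eq_or_ne v 0 with rfl | hv
    · simp [hF0]
    · rw [← fundamentalTensor_self hFsmooth hFhomog (neg_ne_zero.2 hv), fundamentalTensor_neg_neg]
      exact h (-v) (neg_ne_zero.2 hv) v hv
  exact ⟨hsmooth, hconvex, fun h₁ h₂ => le_min
    (sSup_div_neg_le_sqrt hFnonneg (zero_le_one.trans hS) (hsmooth h₁))
    (sSup_div_neg_le_sqrt hFnonneg (zero_le_one.trans hC) (hconvex h₂))⟩
end
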